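/- Let G be a unicyclic graph with cycle C of length g. If g is odd, then dim(G) ≤ edim(G), and the inequality is strict if G is ABC-negative and ADE-positive. If g is even, then dim(G) ≥ edim(G), and the inequality is strict if G is ABC-positive and ADE-negative. -/

import Mathlib

open SimpleGraph

section Defs

variable {V : Type*}

/-- Distance from a vertex `s` to an edge `e`: the minimum of the distances to its endpoints. -/
noncomputable def edgeDist (G : SimpleGraph V) (s : V) (e : Sym2 V) : ℕ :=
  Sym2.lift ⟨fun u w => min (G.dist s u) (G.dist s w), fun u w => min_comm _ _⟩ e

/-- `S` is a vertex metric generator of `G`. -/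
def IsVertexMG (G : SimpleGraph V) (S : Set V) : Prop :=
  ∀ u v : V, u ≠ v → ∃ s ∈ S, G.dist s u ≠ G.dist s v

/-- `S` is an edge metric generator of `G`. -/
def IsEdgeMG (G : SimpleGraph V) (S : Set V) : Prop :=
  ∀ e ∈ G.edgeSet, ∀ f ∈ G.edgeSet, e ≠ f → ∃ s ∈ S, edgeDist G s e ≠ edgeDist G s f

/-- The vertex metric dimension of `G`. -/
noncomputable def metricDim (G : SimpleGraph V) : ℕ :=
  sInf {n | ∃ S : Finset V, S.card = n ∧ IsVertexMG G ↑S}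

/-- The edge metric dimension of `G`. -/
noncomputable def edgeMetricDim (G : SimpleGraph V) : ℕ :=
  sInf {n | ∃ S : Finset V, S.card = n ∧ IsEdgeMG G ↑S}

/-- `G` is unicyclic: connected, contains a cycle, and any two cycles have the same edges. -/
def IsUnicyclic (G : SimpleGraph V) : Prop :=
  G.Connected ∧ (∃ (u : V) (w : G.Walk u u), w.IsCycle) ∧
    ∀ (u u' : V) (w : G.Walk u u) (w' : G.Walk u' u'), w.IsCycle → w'.IsCycle →
      ∀ e, e ∈ w.edges ↔ e ∈ w'.edges

/-- `vc : ZMod g → V` is a labelling `v_0 v_1 ⋯ v_{g-1}` of a cycle of length `g` in `G`. -/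
def IsCycleLabelling (G : SimpleGraph V) (g : ℕ) (vc : ZMod g → V) : Prop :=
  Function.Injective vc ∧ ∀ i : ZMod g, G.Adj (vc i) (vc (i + 1))

/-- The set of edges of the cycle `C`. -/
def cycleEdges (g : ℕ) (vc : ZMod g → V) : Set (Sym2 V) :=
  {e | ∃ i : ZMod g, e = s(vc i, vc (i + 1))}

/-- The graph `G - E(C)`. -/
def offCycle (G : SimpleGraph V) (g : ℕ) (vc : ZMod g → V) : SimpleGraph V :=
  G.deleteEdges (cycleEdges g vc)

/-- `x` belongs to `T_{v_i}`, the connected component of `G - E(C)` containing `v_i`. -/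
def inTree (G : SimpleGraph V) (g : ℕ) (vc : ZMod g → V) (i : ZMod g) (x : V) : Prop :=
  (offCycle G g vc).Reachable (vc i) x

/-- The vertex `v_i` of the cycle is `S`-active: `T_{v_i}` contains a vertex of `S`. -/
def SActive (G : SimpleGraph V) (g : ℕ) (vc : ZMod g → V) (S : Set V) (i : ZMod g) : Prop :=
  ∃ s ∈ S, inTree G g vc i s

/-- `a_S(C)`: the number of `S`-active vertices on the cycle. -/
noncomputable def aS (G : SimpleGraph V) (g : ℕ) (vc : ZMod g → V) (S : Set V) : ℕ :=
  {i : ZMod g | SActive G g vc S i}.ncard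

/-- `S` is biactive: `a_S(C) ≥ 2`. -/
def Biactive (G : SimpleGraph V) (g : ℕ) (vc : ZMod g → V) (S : Set V) : Prop :=
  2 ≤ aS G g vc S

variable [Fintype V] [DecidableEq V]

/-- `t = u_1 u_2 ⋯ u_k` is a thread hanging at the vertex `v`. -/
def IsThreadAt (G : SimpleGraph V) [DecidableRel G.Adj] (v : V) (t : List V) : Prop :=
  t ≠ [] ∧ t.Nodup ∧ v ∉ t ∧ 3 ≤ G.degree v ∧ List.Chain' G.Adj t ∧
    (∀ u ∈ t.head?, G.Adj v u) ∧ (∀ u ∈ t.getLast?, G.degree u = 1) ∧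
    ∀ u ∈ t.dropLast, G.degree u = 2

/-- The thread `t` is `S`-free: it contains no vertex of `S`. -/
def SFree (S : Set V) (t : List V) : Prop := ∀ u ∈ t, u ∉ S

/-- `S` is branch-resolving: for every vertex, all threads hanging at it except possibly
one contain a vertex of `S` (i.e. at most one thread at each vertex is `S`-free). -/
def BranchResolving (G : SimpleGraph V) [DecidableRel G.Adj] (S : Set V) : Prop :=
  ∀ v : V, ∀ t₁ t₂ : List V, IsThreadAt G v t₁ → IsThreadAt G v t₂ → t₁ ≠ t₂ →
    (∃ s ∈ S, s ∈ t₁) ∨ (∃ s ∈ S, s ∈ t₂)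

/-- `ℓ(v)`: the number of threads hanging at `v`. -/
noncomputable def numThreads (G : SimpleGraph V) [DecidableRel G.Adj] (v : V) : ℕ :=
  {t : List V | IsThreadAt G v t}.ncard

/-- `L(G) = Σ (ℓ(v) - 1)` (truncated subtraction makes the sum run exactly over the
vertices with `ℓ(v) > 1`). -/
noncomputable def LG (G : SimpleGraph V) [DecidableRel G.Adj] : ℕ :=
  ∑ v : V, (numThreads G v - 1)

/-- `x` is a branching vertex of the unicyclic graph with cycle `vc`. -/
def Branching (G : SimpleGraph V) [DecidableRel G.Adj] (g : ℕ) (vc : ZMod g → V) (x : V) :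
    Prop :=
  (x ∉ Set.range vc ∧ 3 ≤ G.degree x) ∨ (x ∈ Set.range vc ∧ 4 ≤ G.degree x)

/-- The cycle vertex `v_i` is branch-active: `T_{v_i}` contains a branching vertex. -/
def BranchActive (G : SimpleGraph V) [DecidableRel G.Adj] (g : ℕ) (vc : ZMod g → V)
    (i : ZMod g) : Prop :=
  ∃ x, inTree G g vc i x ∧ Branching G g vc x

/-- `b(G)`: the number of branch-active vertices on the cycle. -/
noncomputable def bG (G : SimpleGraph V) [DecidableRel G.Adj] (g : ℕ) (vc : ZMod g → V) : ℕ :=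
  {i : ZMod g | BranchActive G g vc i}.ncard

/-- `k = max { i : v_i is S-active }` for the labelling `vc` (indices taken in `[0, g-1]`). -/
noncomputable def kOf (G : SimpleGraph V) (g : ℕ) (vc : ZMod g → V) (S : Set V) : ℕ :=
  sSup {n : ℕ | n < g ∧ SActive G g vc S (n : ZMod g)}

/-- The labelling `vc` of the cycle is canonical with respect to `S`: `v_0` is `S`-active
and `k` is as small as possible among all labellings of the cycle with `v_0` `S`-active. -/
def Canonical (G : SimpleGraph V) (g : ℕ) (vc : ZMod g → V) (S : Set V) : Prop :=
  IsCycleLabelling G g vc ∧ SActive G g vc S 0 ∧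
    ∀ vc' : ZMod g → V, IsCycleLabelling G g vc' → Set.range vc' = Set.range vc →
      SActive G g vc' S 0 → kOf G g vc S ≤ kOf G g vc' S

/-- Configuration 𝒜 : `a_S(C) = 2`, `g` even and `k = g/2`. -/
def ConfigA (G : SimpleGraph V) (g : ℕ) (vc : ZMod g → V) (S : Set V) : Prop :=
  aS G g vc S = 2 ∧ Even g ∧ kOf G g vc S = g / 2

/-- Configuration ℬ : `k ≤ ⌊g/2⌋ - 1` and an `S`-free thread hangs at `v_i` for some
`i ∈ [k, ⌊g/2⌋-1] ∪ [⌈g/2⌉+k+1, g-1] ∪ {0}`. -/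
def ConfigB (G : SimpleGraph V) [DecidableRel G.Adj] (g : ℕ) (vc : ZMod g → V) (S : Set V) :
    Prop :=
  kOf G g vc S ≤ g / 2 - 1 ∧
    ∃ i : ℕ, ((kOf G g vc S ≤ i ∧ i ≤ g / 2 - 1) ∨
        ((g + 1) / 2 + kOf G g vc S + 1 ≤ i ∧ i ≤ g - 1) ∨ i = 0) ∧
      ∃ t : List V, IsThreadAt G (vc (i : ZMod g)) t ∧ SFree S t

/-- Configuration 𝒞 : `a_S(C) = 2`, `g` even, `k ≤ g/2` and an `S`-free thread of length
`≥ g/2 - k` hangs at `v_i` for some `i ∈ [0, k]`. -/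
def ConfigC (G : SimpleGraph V) [DecidableRel G.Adj] (g : ℕ) (vc : ZMod g → V) (S : Set V) :
    Prop :=
  aS G g vc S = 2 ∧ Even g ∧ kOf G g vc S ≤ g / 2 ∧
    ∃ i : ℕ, i ≤ kOf G g vc S ∧
      ∃ t : List V, IsThreadAt G (vc (i : ZMod g)) t ∧ SFree S t ∧
        g / 2 - kOf G g vc S ≤ t.length

/-- Configuration 𝒟 : `k ≤ ⌈g/2⌉ - 1` and an `S`-free thread hangs at `v_i` for some
`i ∈ [k, ⌈g/2⌉-1] ∪ [⌊g/2⌋+k+1, g-1] ∪ {0}`. -/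
def ConfigD (G : SimpleGraph V) [DecidableRel G.Adj] (g : ℕ) (vc : ZMod g → V) (S : Set V) :
    Prop :=
  kOf G g vc S ≤ (g + 1) / 2 - 1 ∧
    ∃ i : ℕ, ((kOf G g vc S ≤ i ∧ i ≤ (g + 1) / 2 - 1) ∨
        (g / 2 + kOf G g vc S + 1 ≤ i ∧ i ≤ g - 1) ∨ i = 0) ∧
      ∃ t : List V, IsThreadAt G (vc (i : ZMod g)) t ∧ SFree S t

/-- Configuration ℰ : `a_S(C) = 2` and an `S`-free thread of length `≥ ⌊g/2⌋ - k + 1`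
hangs at `v_i` with `i ∈ [0, k]`; moreover if `g` is even an `S`-free thread hangs at
`v_j` with `j = g/2 + k - i`. -/
def ConfigE (G : SimpleGraph V) [DecidableRel G.Adj] (g : ℕ) (vc : ZMod g → V) (S : Set V) :
    Prop :=
  aS G g vc S = 2 ∧
    ∃ i : ℕ, i ≤ kOf G g vc S ∧
      (∃ t : List V, IsThreadAt G (vc (i : ZMod g)) t ∧ SFree S t ∧
        g / 2 - kOf G g vc S + 1 ≤ t.length) ∧
      (Even g → ∃ t' : List V,
        IsThreadAt G (vc ((g / 2 + kOf G g vc S - i : ℕ) : ZMod g)) t' ∧ SFree S t')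

/-- `G` contains configuration 𝒜 with respect to `S` (evaluated on a canonical labelling
of the cycle given by `vc`). -/
def ContainsA (G : SimpleGraph V) (g : ℕ) (vc : ZMod g → V) (S : Set V) : Prop :=
  ∃ vc' : ZMod g → V, IsCycleLabelling G g vc' ∧ Set.range vc' = Set.range vc ∧
    Canonical G g vc' S ∧ ConfigA G g vc' S

/-- `G` contains configuration ℬ with respect to `S`. -/
def ContainsB (G : SimpleGraph V) [DecidableRel G.Adj] (g : ℕ) (vc : ZMod g → V)
    (S : Set V) : Prop :=
  ∃ vc' : ZMod g → V, IsCycleLabelling G g vc' ∧ Set.range vc' = Set.range vc ∧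
    Canonical G g vc' S ∧ ConfigB G g vc' S

/-- `G` contains configuration 𝒞 with respect to `S`. -/
def ContainsC (G : SimpleGraph V) [DecidableRel G.Adj] (g : ℕ) (vc : ZMod g → V)
    (S : Set V) : Prop :=
  ∃ vc' : ZMod g → V, IsCycleLabelling G g vc' ∧ Set.range vc' = Set.range vc ∧
    Canonical G g vc' S ∧ ConfigC G g vc' S

/-- `G` contains configuration 𝒟 with respect to `S`. -/
def ContainsD (G : SimpleGraph V) [DecidableRel G.Adj] (g : ℕ) (vc : ZMod g → V)
    (S : Set V) : Prop :=
  ∃ vc' : ZMod g → V, IsCycleLabelling G g vc' ∧ Set.range vc' = Set.range vc ∧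
    Canonical G g vc' S ∧ ConfigD G g vc' S

/-- `G` contains configuration ℰ with respect to `S`. -/
def ContainsE (G : SimpleGraph V) [DecidableRel G.Adj] (g : ℕ) (vc : ZMod g → V)
    (S : Set V) : Prop :=
  ∃ vc' : ZMod g → V, IsCycleLabelling G g vc' ∧ Set.range vc' = Set.range vc ∧
    Canonical G g vc' S ∧ ConfigE G g vc' S

/-- `G` contains one of the configurations 𝒜, ℬ, 𝒞 with respect to `S`. -/
def ContainsABC (G : SimpleGraph V) [DecidableRel G.Adj] (g : ℕ) (vc : ZMod g → V)
    (S : Set V) : Prop :=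
  ContainsA G g vc S ∨ ContainsB G g vc S ∨ ContainsC G g vc S

/-- `G` contains one of the configurations 𝒜, 𝒟, ℰ with respect to `S`. -/
def ContainsADE (G : SimpleGraph V) [DecidableRel G.Adj] (g : ℕ) (vc : ZMod g → V)
    (S : Set V) : Prop :=
  ContainsA G g vc S ∨ ContainsD G g vc S ∨ ContainsE G g vc S

/-- `S` is a smallest branch-resolving set of `G`. -/
def SmallestBR (G : SimpleGraph V) [DecidableRel G.Adj] (S : Finset V) : Prop :=
  BranchResolving G ↑S ∧ ∀ S' : Finset V, BranchResolving G ↑S' → S.card ≤ S'.card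

/-- `S` is a smallest biactive branch-resolving set of `G`. -/
def SmallestBBR (G : SimpleGraph V) [DecidableRel G.Adj] (g : ℕ) (vc : ZMod g → V)
    (S : Finset V) : Prop :=
  BranchResolving G ↑S ∧ Biactive G g vc ↑S ∧
    ∀ S' : Finset V, BranchResolving G ↑S' → Biactive G g vc ↑S' → S.card ≤ S'.card

/-- `G` is 𝒜ℬ𝒞-negative. -/
def ABCneg (G : SimpleGraph V) [DecidableRel G.Adj] (g : ℕ) (vc : ZMod g → V) : Prop :=
  ∃ S : Finset V, SmallestBBR G g vc S ∧ ¬ ContainsABC G g vc ↑S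

/-- `G` is 𝒜𝒟ℰ-negative. -/
def ADEneg (G : SimpleGraph V) [DecidableRel G.Adj] (g : ℕ) (vc : ZMod g → V) : Prop :=
  ∃ S : Finset V, SmallestBBR G g vc S ∧ ¬ ContainsADE G g vc ↑S

end Defs

/-- The structure of a unicyclic graph with cycle `vc`: every vertex `x` lies in the tree hanging
at `vc (root x)`, at depth `height x`, with parent `par x`. -/
structure CycleForest {V : Type*} (G : SimpleGraph V) (g : ℕ) (vc : ZMod g → V) where
  root : V → ZMod g
  height : V → ℕ
  par : V → V
  inTree_iff : ∀ i x, inTree G g vc i x ↔ root x = i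
  root_vc : ∀ i, root (vc i) = i
  height_vc : ∀ i, height (vc i) = 0
  eq_vc : ∀ x, height x = 0 → x = vc (root x)
  par_of_height : ∀ x, height x = 0 → par x = x
  par_adj : ∀ x, 0 < height x → G.Adj (par x) x
  height_par : ∀ x, 0 < height x → height (par x) + 1 = height x
  root_par : ∀ x, root (par x) = root x
  adj_cases : ∀ x y, G.Adj x y → (0 < height x ∧ y = par x) ∨ (0 < height y ∧ x = par y) ∨
    (height x = 0 ∧ height y = 0 ∧ (root y = root x + 1 ∨ root x = root y + 1))

section Unicyclic

variable {V : Type*} {G : SimpleGraph V} {g : ℕ} {vc : ZMod g → V}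

lemma ZMod.natCast_ne_zero_of_lt {g m : ℕ} (h0 : 0 < m) (h : m < g) : (m : ZMod g) ≠ 0 := by
  rw [Ne, ZMod.natCast_eq_zero_iff]
  exact fun hd => absurd (Nat.le_of_dvd h0 hd) (by omega)

lemma IsCycleLabelling.edge_inj (hg : 3 ≤ g) (hvc : IsCycleLabelling G g vc) {a b : ZMod g}
    (h : s(vc a, vc (a + 1)) = s(vc b, vc (b + 1))) : a = b := by
  rcases Sym2.eq_iff.1 h with ⟨h1, -⟩ | ⟨h1, h2⟩
  · exact hvc.1 h1
  · have h1 := hvc.1 h1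
    have h2 := hvc.1 h2
    exact absurd (show ((2 : ℕ) : ZMod g) = 0 by push_cast; linear_combination h2 - h1)
      (ZMod.natCast_ne_zero_of_lt (by omega) (by omega))

lemma reachable_arc {K : SimpleGraph V} (c : ZMod g) (n : ℕ)
    (h : ∀ m < n, K.Adj (vc (c + m)) (vc (c + m + 1))) : K.Reachable (vc c) (vc (c + n)) := by
  induction n with
  | zero => simp
  | succ n ih =>
    refine (ih fun m hm => h m (by omega)).trans ?_
    have := (h n (by omega)).reachable
    rwa [add_assoc, ← Nat.cast_succ] at this

lemma IsCycleLabelling.mem_edges_of_isCycle (hg : 3 ≤ g) (hG : IsUnicyclic G)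
    (hvc : IsCycleLabelling G g vc) (i : ZMod g) {u : V} (w : G.Walk u u) (hw : w.IsCycle) :
    s(vc i, vc (i + 1)) ∈ w.edges := by
  have hnb : ¬ G.IsBridge s(vc i, vc (i + 1)) := by
    rw [isBridge_iff, not_not]
    have := reachable_arc (vc := vc) (K := G.deleteEdges {s(vc i, vc (i + 1))}) (i + 1) (g - 1)
      fun m hm => by
        rw [deleteEdges_adj]
        refine ⟨hvc.2 _, fun h => ?_⟩
        have := hvc.edge_inj hg h
        exact ZMod.natCast_ne_zero_of_lt (g := g) (m := m + 1) (by omega) (by omega)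
          (by push_cast; linear_combination this)
    have e : i + 1 + ((g - 1 : ℕ) : ZMod g) = i := by
      rw [Nat.cast_sub (by omega)]; simp
    rw [e] at this
    exact this.symm
  rw [isBridge_iff_forall_cycle_notMem (hvc.2 i)] at hnb
  push Not at hnb
  obtain ⟨u', p, hp, hmem⟩ := hnb
  exact (hG.2.2 _ _ p w hp hw _).1 hmem

lemma offCycle_isAcyclic (hg : 3 ≤ g) (hG : IsUnicyclic G) (hvc : IsCycleLabelling G g vc) :
    (offCycle G g vc).IsAcyclic := by
  intro u w hw
  have hle : offCycle G g vc ≤ G := deleteEdges_le _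
  have := hvc.mem_edges_of_isCycle hg hG 0 (w.mapLe hle) (hw.mapLe hle)
  rw [Walk.edges_mapLe_eq_edges] at this
  have := w.edges_subset_edgeSet this
  rw [mem_edgeSet, offCycle, deleteEdges_adj] at this
  exact this.2 ⟨0, rfl⟩

lemma eq_of_inTree (hg : 3 ≤ g) (hG : IsUnicyclic G) (hvc : IsCycleLabelling G g vc)
    {i j : ZMod g} (h : inTree G g vc i (vc j)) : i = j := by
  have : NeZero g := ⟨by omega⟩
  by_contra hij
  set G' := G.deleteEdges {s(vc i, vc (i + 1))} with hG'
  have hle : G' ≤ G := deleteEdges_le _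
  set G'' := G'.deleteEdges {s(vc (i - 1), vc (i - 1 + 1))} with hG''
  have harc : ∀ n ≤ g - 2, G''.Reachable (vc (i + 1)) (vc (i + 1 + n)) := by
    refine fun n hn => reachable_arc _ _ fun m hm => ?_
    rw [hG'', hG', deleteEdges_adj, deleteEdges_adj]
    refine ⟨⟨hvc.2 _, fun h => ?_⟩, fun h => ?_⟩
    · have := hvc.edge_inj hg h
      exact ZMod.natCast_ne_zero_of_lt (g := g) (m := m + 1) (by omega) (by omega)
        (by push_cast; linear_combination this)
    · have := hvc.edge_inj hg h
      exact ZMod.natCast_ne_zero_of_lt (g := g) (m := m + 2) (by omega) (by omega)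
        (by push_cast; linear_combination this)
  have h1 : G''.Reachable (vc i) (vc j) := by
    refine Reachable.mono ?_ h
    intro a b hab
    rw [offCycle, deleteEdges_adj] at hab
    rw [hG'', hG', deleteEdges_adj, deleteEdges_adj]
    exact ⟨⟨hab.1, fun h => hab.2 ⟨_, h⟩⟩, fun h => hab.2 ⟨_, h⟩⟩
  have h2 : G''.Reachable (vc (i + 1)) (vc j) := by
    have hlt := ZMod.val_lt (j - i - 1)
    have hne : (j - i - 1).val ≠ g - 1 := fun h => hij <| by
      have : ((j - i - 1).val : ZMod g) = ((g - 1 : ℕ) : ZMod g) := by rw [h]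
      rw [ZMod.natCast_val, ZMod.cast_id, Nat.cast_sub (by omega)] at this
      simp only [CharP.cast_eq_zero, Nat.cast_one] at this
      linear_combination -this
    have := harc (j - i - 1).val (by omega)
    rw [ZMod.natCast_val, ZMod.cast_id] at this
    convert this using 2
    ring
  have h3 : G''.Reachable (vc (i + 1)) (vc (i - 1)) := by
    have := harc (g - 2) le_rfl
    rw [Nat.cast_sub (by omega)] at this
    convert this using 2
    push_cast
    simp only [CharP.cast_eq_zero]
    ring
  have hnb : ¬ G'.IsBridge s(vc (i - 1), vc (i - 1 + 1)) := by
    rw [isBridge_iff, not_not]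
    have := (h1.trans (h2.symm.trans h3)).symm
    rwa [show i = i - 1 + 1 by ring, show i - 1 + 1 - 1 = i - 1 by ring] at this
  have hmem : s(vc (i - 1), vc (i - 1 + 1)) ∈ G'.edgeSet := by
    rw [mem_edgeSet, hG', deleteEdges_adj]
    refine ⟨hvc.2 _, fun h => ?_⟩
    have := hvc.edge_inj hg h
    exact ZMod.natCast_ne_zero_of_lt (g := g) (m := 1) (by omega) (by omega)
        (by push_cast; linear_combination -this)
  rw [isBridge_iff_forall_cycle_notMem hmem] at hnb
  push Not at hnb
  obtain ⟨u', p, hp, -⟩ := hnb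
  have := hvc.mem_edges_of_isCycle hg hG i (p.mapLe hle) (hp.mapLe hle)
  rw [Walk.edges_mapLe_eq_edges] at this
  have := p.edges_subset_edgeSet this
  rw [mem_edgeSet, hG', deleteEdges_adj] at this
  exact this.2 rfl

lemma exists_inTree (hG : IsUnicyclic G) (x : V) : ∃ i, inTree G g vc i x := by
  obtain ⟨w⟩ := hG.1.preconnected x (vc 0)
  induction hw : w.length generalizing x with
  | zero => exact ⟨0, by rw [Walk.eq_of_length_eq_zero hw]; exact Reachable.refl _⟩
  | succ n ih =>
    cases w with
    | nil => simp at hw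
    | cons hadj p =>
      rename_i y
      by_cases hc : s(x, y) ∈ cycleEdges g vc
      · obtain ⟨i, hi⟩ := hc
        rcases Sym2.eq_iff.1 hi with ⟨rfl, -⟩ | ⟨rfl, -⟩
        exacts [⟨i, Reachable.refl _⟩, ⟨i + 1, Reachable.refl _⟩]
      · obtain ⟨i, hi⟩ := ih y p (by simpa using hw)
        refine ⟨i, hi.trans (Adj.reachable ?_)⟩
        rw [offCycle, deleteEdges_adj]
        exact ⟨hadj.symm, by rwa [Sym2.eq_swap]⟩

lemma SimpleGraph.IsAcyclic.eq_of_adj_of_dist_lt {H : SimpleGraph V} (hH : H.IsAcyclic)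
    {r x y z : V} (hr : H.Reachable r x) (hy : H.Adj x y) (hz : H.Adj x z)
    (hdy : H.dist r y < H.dist r x) (hdz : H.dist r z < H.dist r x) : y = z := by
  classical
  obtain ⟨p, hp, -⟩ := hr.exists_path_of_dist
  have key : ∀ y, H.Adj x y → H.dist r y < H.dist r x → y = p.penultimate := by
    intro y hy hdy
    obtain ⟨q, hq, hql⟩ := (hr.trans hy.reachable).exists_path_of_dist
    refine hH.eq_penultimate_of_adj_end hp hy
      (hH.mem_support_of_ne_mem_support_of_adj_of_isPath hp hq hy fun hx => ?_)
    have := (dist_le (q.takeUntil x hx)).trans (q.length_takeUntil_le_length hx)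
    omega
  rw [key y hy hdy, key z hz hdz]

lemma exists_adj_dist {H : SimpleGraph V} {r x : V} (hr : H.Reachable r x) (h : 0 < H.dist r x) :
    ∃ y, H.Adj y x ∧ H.dist r y + 1 = H.dist r x := by
  obtain ⟨p, hp⟩ := hr.exists_walk_length_eq_dist
  have hn : ¬ p.Nil := by
    intro hn
    rw [← Walk.length_eq_zero_iff] at hn
    omega
  have hadj := p.adj_penultimate hn
  refine ⟨_, hadj, ?_⟩
  have h1 := dist_le p.dropLast
  have h2 := hadj.diff_dist_adj (u := r)
  have h3 : p.dropLast.length + 1 = p.length := by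
    have := congrArg Walk.length (p.concat_dropLast hadj)
    rwa [Walk.length_concat] at this
  omega

theorem CycleForest.exists (hg : 3 ≤ g) (hG : IsUnicyclic G) (hvc : IsCycleLabelling G g vc) :
    Nonempty (CycleForest G g vc) := by
  classical
  set H := offCycle G g vc with hH
  have hac : H.IsAcyclic := offCycle_isAcyclic hg hG hvc
  choose root hroot using fun x => exists_inTree (g := g) (vc := vc) hG x
  have huniq : ∀ i x, inTree G g vc i x ↔ root x = i := by
    refine fun i x => ⟨fun h => ?_, fun h => h ▸ hroot x⟩
    exact eq_of_inTree hg hG hvc ((hroot x).trans h.symm)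
  have hrvc : ∀ i, root (vc i) = i := fun i => (huniq _ _).1 (Reachable.refl _)
  have hradj : ∀ x y, H.Adj x y → root y = root x := fun x y h =>
    (huniq _ _).1 ((hroot x).trans h.reachable)
  set height : V → ℕ := fun x => H.dist (vc (root x)) x with hheight
  have hex : ∀ x, ∃ y, (height x = 0 → y = x) ∧
      (0 < height x → H.Adj y x ∧ height y + 1 = height x) ∧ root y = root x := by
    intro x
    by_cases h : height x = 0
    · exact ⟨x, fun _ => rfl, fun h' => by omega, rfl⟩
    · obtain ⟨y, hy, hd⟩ := exists_adj_dist (hroot x) (by change 0 < height x; omega)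
      have hr := hradj _ _ hy
      refine ⟨y, fun h' => by omega, fun _ => ⟨hy, ?_⟩, hr.symm⟩
      simp only [hheight]
      rw [← hr]; exact hd
  choose par hpar0 hpar hrpar using hex
  have hle : H ≤ G := deleteEdges_le _
  have hzero : ∀ x, height x = 0 → x = vc (root x) := fun x hx =>
    ((hroot x).dist_eq_zero_iff.1 hx).symm
  have hvc0 : ∀ i, height (vc i) = 0 := fun i => by simp [hheight, hrvc]
  have hdown : ∀ x y, H.Adj x y → height y < height x → y = par x := by
    intro x y hxy hlt
    obtain ⟨h1, h2⟩ := hpar x (by omega)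
    have e1 := hradj _ _ hxy
    have e2 := hrpar x
    simp only [hheight] at h2 hlt
    rw [e2] at h2
    rw [e1] at hlt
    exact hac.eq_of_adj_of_dist_lt (hroot x) hxy h1.symm hlt (by omega)
  refine ⟨⟨root, height, par, huniq, hrvc, hvc0, hzero, hpar0, fun x hx => hle (hpar x hx).1,
    fun x hx => (hpar x hx).2, hrpar, ?_⟩⟩
  intro x y hxy
  by_cases hc : s(x, y) ∈ cycleEdges g vc
  · obtain ⟨i, hi⟩ := hc
    rcases Sym2.eq_iff.1 hi with ⟨rfl, rfl⟩ | ⟨rfl, rfl⟩ <;> simp [hrvc, hvc0]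
  · have hadj : H.Adj x y := by rw [hH, offCycle, deleteEdges_adj]; exact ⟨hxy, hc⟩
    have hne := hac.dist_ne_of_adj hadj (hroot x)
    have e := hradj _ _ hadj
    rcases lt_or_gt_of_ne hne with h | h
    · have h' : height x < height y := by simpa only [hheight, e] using h
      exact Or.inr (Or.inl ⟨by omega, hdown _ _ hadj.symm h'⟩)
    · have h' : height y < height x := by simpa only [hheight, e] using h
      exact Or.inl ⟨by omega, hdown _ _ hadj h'⟩

end Unicyclic

section GraphDistance

variable {V : Type*} {G : SimpleGraph V}

lemma SimpleGraph.Connected.le_add_dist (hG : G.Connected) {f : V → ℕ}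
    (hf : ∀ x y, G.Adj x y → f x ≤ f y + 1) (x y : V) : f x ≤ f y + G.dist x y := by
  obtain ⟨p, hp⟩ := hG.exists_walk_length_eq_dist x y
  rw [← hp]
  clear hp
  induction p with
  | nil => simp
  | cons h p ih =>
    have := hf _ _ h
    rw [Walk.length_cons]
    omega

/-- If `w` separates `y ∈ B` from `s ∉ B`, then shortest paths from `s` to `y` go through `w`. -/
lemma SimpleGraph.Connected.dist_eq_of_cut (hG : G.Connected) {B : Set V} {w s y : V}
    (hB : ∀ x ∈ B, ∀ z ∉ B, G.Adj x z → z = w) (hs : s ∉ B) (hy : y ∈ B) :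
    G.dist s y = G.dist s w + G.dist w y := by
  refine le_antisymm hG.dist_triangle ?_
  obtain ⟨p, hp⟩ := hG.exists_walk_length_eq_dist y s
  rw [G.dist_comm (u := s) (v := y), ← hp, G.dist_comm (u := s), G.dist_comm (u := w) (v := y)]
  clear hp
  induction p with
  | nil => exact absurd hy hs
  | @cons y z s hadj p ih =>
    rw [Walk.length_cons]
    have h1 := dist_eq_one_iff_adj.2 hadj
    by_cases hz : z ∈ B
    · have := ih hs hz
      have := hG.dist_triangle (u := y) (v := z) (w := w)
      omega
    · obtain rfl := hB _ hy _ hz hadj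
      have := dist_le p
      omega

end GraphDistance

/-- The distance between the vertices numbered `m` and `n` on a cycle of length `g`. -/
def cycDist (g m n : ℕ) : ℕ := min (m - n + (n - m)) (g - (m - n + (n - m)))

lemma ZMod.val_add_one_cases {g : ℕ} (hg : 3 ≤ g) (a : ZMod g) :
    (a + 1).val = a.val + 1 ∨ ((a + 1).val = 0 ∧ a.val + 1 = g) := by
  have : NeZero g := ⟨by omega⟩
  have : Fact (1 < g) := ⟨by omega⟩
  rcases lt_or_ge (a.val + (1 : ZMod g).val) g with h | h
  · left
    rw [ZMod.val_add_of_lt h, ZMod.val_one]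
  · right
    have := ZMod.val_add_val_of_le h
    have := a.val_lt
    rw [ZMod.val_one] at *
    omega

lemma ZMod.val_sub_cases {g : ℕ} [NeZero g] (a b : ZMod g) :
    (a - b).val + b.val = a.val ∨ (a - b).val + b.val = a.val + g := by
  rcases lt_or_ge ((a - b).val + b.val) g with h | h
  · left
    rw [← ZMod.val_add_of_lt h, sub_add_cancel]
  · right
    have := ZMod.val_add_val_of_le h
    rw [sub_add_cancel] at this
    omega

namespace CycleForest

variable {V : Type*} {G : SimpleGraph V} {g : ℕ} {vc : ZMod g → V} (F : CycleForest G g vc)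

/-- `x` is a descendant of `a`. -/
def Desc (a x : V) : Prop := ∃ n, F.par^[n] x = a

lemma height_par' (x : V) : F.height (F.par x) = F.height x - 1 := by
  rcases Nat.eq_zero_or_pos (F.height x) with h | h
  · rw [F.par_of_height x h, h]
  · have := F.height_par x h
    omega

lemma height_iterate (n : ℕ) (x : V) : F.height (F.par^[n] x) = F.height x - n := by
  induction n with
  | zero => simp
  | succ n ih => rw [Function.iterate_succ_apply', height_par', ih]; omega

lemma root_iterate (n : ℕ) (x : V) : F.root (F.par^[n] x) = F.root x := by
  induction n with
  | zero => simp
  | succ n ih => rw [Function.iterate_succ_apply', root_par, ih]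

lemma iterate_height (x : V) : F.par^[F.height x] x = vc (F.root x) := by
  have h := F.eq_vc (F.par^[F.height x] x) (by rw [height_iterate]; omega)
  rwa [root_iterate] at h

lemma Desc.root_eq {F : CycleForest G g vc} {a x : V} (h : F.Desc a x) : F.root x = F.root a := by
  obtain ⟨n, rfl⟩ := h
  exact (F.root_iterate n x).symm

lemma Desc.height_le {F : CycleForest G g vc} {a x : V} (h : F.Desc a x) :
    F.height a ≤ F.height x := by
  obtain ⟨n, rfl⟩ := h
  rw [height_iterate]; omega

lemma desc_iff {a x : V} (ha : 0 < F.height a) :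
    F.Desc a x ↔ F.height a ≤ F.height x ∧ F.par^[F.height x - F.height a] x = a := by
  refine ⟨fun h => ⟨h.height_le, ?_⟩, fun h => ⟨_, h.2⟩⟩
  obtain ⟨n, rfl⟩ := h
  rw [height_iterate] at ha ⊢
  congr 2
  omega

lemma Desc.unique {F : CycleForest G g vc} {a b x : V} (ha : F.Desc a x) (hb : F.Desc b x)
    (hab : F.height a = F.height b) (h0 : 0 < F.height a) : a = b := by
  have h1 := ((F.desc_iff h0).1 ha).2
  have h2 := ((F.desc_iff (hab ▸ h0)).1 hb).2
  rw [← h1, ← h2, hab]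

lemma desc_refl (x : V) : F.Desc x x := ⟨0, rfl⟩

lemma Desc.of_par {F : CycleForest G g vc} {a x : V} (h : F.Desc a (F.par x)) : F.Desc a x := by
  obtain ⟨n, hn⟩ := h
  exact ⟨n + 1, hn⟩

lemma Desc.par_or_eq {F : CycleForest G g vc} {a x : V} (h : F.Desc a x) :
    x = a ∨ F.Desc a (F.par x) := by
  obtain ⟨n, hn⟩ := h
  cases n with
  | zero => exact Or.inl hn
  | succ n => exact Or.inr ⟨n, hn⟩

lemma height_le_of_adj (x y : V) (h : G.Adj x y) : F.height x ≤ F.height y + 1 := by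
  rcases F.adj_cases x y h with ⟨h', rfl⟩ | ⟨h', rfl⟩ | ⟨h', -⟩
  · have := F.height_par x h'; omega
  · have := F.height_par y h'; omega
  · omega

lemma eq_par_of_cut {a x y : V} (ha : 0 < F.height a) (hx : F.Desc a x) (hy : ¬ F.Desc a y)
    (h : G.Adj x y) : y = F.par a := by
  have := hx.height_le
  rcases F.adj_cases x y h with ⟨h, rfl⟩ | ⟨h, rfl⟩ | ⟨h, -⟩
  · rcases hx.par_or_eq with rfl | h
    · rfl
    · exact absurd h hy
  · exact absurd hx.of_par hy
  · omega

variable (hG : G.Connected)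

include hG

lemma dist_iterate_le (n : ℕ) (x : V) : G.dist (F.par^[n] x) x ≤ n := by
  induction n with
  | zero => simp
  | succ n ih =>
    rw [Function.iterate_succ_apply']
    have h1 : G.dist (F.par (F.par^[n] x)) (F.par^[n] x) ≤ 1 := by
      rcases Nat.eq_zero_or_pos (F.height (F.par^[n] x)) with h | h
      · rw [F.par_of_height _ h]; simp
      · exact (dist_eq_one_iff_adj.2 (F.par_adj _ h)).le
    have := hG.dist_triangle (u := F.par (F.par^[n] x)) (v := F.par^[n] x) (w := x)
    omega

lemma Desc.dist_add {F : CycleForest G g vc} {a x : V} (h : F.Desc a x) :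
    G.dist a x + F.height a = F.height x := by
  obtain ⟨n, hn⟩ := h
  have h1 := F.height_iterate n x
  have h2 := hG.le_add_dist F.height_le_of_adj x a
  rw [G.dist_comm] at h2
  rw [hn] at h1
  rcases le_total n (F.height x) with h | h
  · have h3 := F.dist_iterate_le hG n x
    rw [hn] at h3
    omega
  · have h3 := F.dist_iterate_le hG (F.height x) x
    rw [F.iterate_height] at h3
    have h4 := F.eq_vc a (by omega)
    have h5 := F.root_iterate n x
    rw [hn] at h5
    rw [← h5, ← h4] at h3
    omega

lemma dist_of_not_desc {a s x : V} (ha : 0 < F.height a) (hx : F.Desc a x) (hs : ¬ F.Desc a s) :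
    G.dist s x + F.height (F.par a) = G.dist s (F.par a) + F.height x := by
  have h1 := hG.dist_eq_of_cut (B := {z | F.Desc a z}) (w := F.par a)
    (fun x hx z hz => F.eq_par_of_cut ha hx hz) hs hx
  have h2 : F.Desc (F.par a) x := by
    obtain ⟨n, rfl⟩ := hx
    exact ⟨n + 1, Function.iterate_succ_apply' _ _ _⟩
  have := h2.dist_add hG
  omega

/-- The neighbour of the cycle above `x` (for `x` off the cycle). -/
def top (F : CycleForest G g vc) (x : V) : V := F.par^[F.height x - 1] x

omit hG in
lemma height_top {x : V} (hx : 0 < F.height x) : F.height (F.top x) = 1 := by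
  rw [top, height_iterate]; omega

omit hG in
lemma par_top {x : V} (hx : 0 < F.height x) : F.par (F.top x) = vc (F.root x) := by
  rw [top, ← Function.iterate_succ_apply' F.par, Nat.succ_eq_add_one, Nat.sub_add_cancel hx,
    iterate_height]

omit hG in
lemma desc_top (x : V) : F.Desc (F.top x) x := ⟨_, rfl⟩

omit hG in
lemma root_top (x : V) : F.root (F.top x) = F.root x := (F.desc_top x).root_eq.symm

lemma dist_of_not_desc_top {s x : V} (hx : 0 < F.height x) (hs : ¬ F.Desc (F.top x) s) :
    G.dist s x = G.dist s (vc (F.root x)) + F.height x := by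
  have := F.dist_of_not_desc hG (by rw [F.height_top hx]; omega) (F.desc_top x) hs
  rw [F.par_top hx, F.height_vc] at this
  exact this

lemma dist_of_root_ne {s x : V} (h : F.root s ≠ F.root x) :
    G.dist s x = G.dist s (vc (F.root x)) + F.height x := by
  rcases Nat.eq_zero_or_pos (F.height x) with h0 | h0
  · rw [h0, ← F.eq_vc x h0, add_zero]
  · refine F.dist_of_not_desc_top hG h0 fun hs => h ?_
    rw [hs.root_eq, root_top]

lemma dist_vc_root (x : V) : G.dist x (vc (F.root x)) = F.height x := by
  have := Desc.dist_add hG (F := F) ⟨_, F.iterate_height x⟩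
  rw [F.height_vc] at this
  rw [G.dist_comm]
  exact this

lemma dist_add_two_le {a s x : V} (ha : 0 < F.height a) (hs : F.Desc a s) (hx : F.Desc a x) :
    G.dist s x + 2 ≤ F.height s + F.height x := by
  have h1 := hs.dist_add hG
  have h2 := hx.dist_add hG
  have h3 := hG.dist_triangle (u := s) (v := a) (w := x)
  rw [G.dist_comm (u := s) (v := a)] at h3
  omega

omit hG in
lemma _root_.IsCycleLabelling.dist_vc_le (hG : G.Connected) [NeZero g]
    (hvc : IsCycleLabelling G g vc) (i j : ZMod g) :
    G.dist (vc i) (vc j) ≤ cycDist g i.val j.val := by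
  have harc : ∀ (c : ZMod g) (n : ℕ), G.dist (vc c) (vc (c + n)) ≤ n := by
    intro c n
    induction n with
    | zero => simp
    | succ n ih =>
      have h1 := dist_eq_one_iff_adj.2 (hvc.2 (c + n))
      have h2 := hG.dist_triangle (u := vc c) (v := vc (c + n)) (w := vc (c + n + 1))
      rw [Nat.cast_succ, ← add_assoc]
      omega
  have key : ∀ i j : ZMod g, G.dist (vc i) (vc j) ≤ (j - i).val := by
    intro i j
    have := harc i (j - i).val
    rwa [ZMod.natCast_val, ZMod.cast_id, add_sub_cancel] at this
  have h1 := key i j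
  have h2 := key j i
  rw [G.dist_comm] at h2
  have := ZMod.val_sub_cases i j
  have := ZMod.val_sub_cases j i
  have := (i - j).val_lt
  have := (j - i).val_lt
  have := i.val_lt
  have := j.val_lt
  unfold cycDist
  omega

include F in
lemma dist_vc_vc (hg : 3 ≤ g) (hvc : IsCycleLabelling G g vc) (i j : ZMod g) :
    G.dist (vc i) (vc j) = cycDist g i.val j.val := by
  have : NeZero g := ⟨by omega⟩
  refine le_antisymm (hvc.dist_vc_le hG i j) ?_
  have := hG.le_add_dist (f := fun x => cycDist g (F.root x).val j.val) (fun x y h => ?_)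
    (vc i) (vc j)
  · simp only [root_vc] at this
    simpa [cycDist] using this
  · rcases F.adj_cases x y h with ⟨h, rfl⟩ | ⟨h, rfl⟩ | ⟨-, -, h⟩
    · simp only [root_par]; omega
    · simp only [root_par]; omega
    · have h1 := (F.root x).val_lt
      have h2 := (F.root y).val_lt
      have h3 := j.val_lt
      have h4 := ZMod.val_add_one_cases hg (F.root x)
      have h5 := ZMod.val_add_one_cases hg (F.root y)
      simp only [cycDist]
      rcases h with h | h <;> rw [h] at * <;> omega

lemma dist_vc (hg : 3 ≤ g) (hvc : IsCycleLabelling G g vc) (s : V) (j : ZMod g) :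
    G.dist s (vc j) = F.height s + cycDist g (F.root s).val j.val := by
  by_cases h : F.root s = j
  · subst h
    rw [F.dist_vc_root hG]
    simp [cycDist]
  · rw [G.dist_comm, F.dist_of_root_ne hG (by rw [root_vc]; exact Ne.symm h), G.dist_comm,
      dist_vc_vc F hG hg hvc, add_comm]

lemma dist_eq (hg : 3 ≤ g) (hvc : IsCycleLabelling G g vc) {s x : V} (h : F.root s ≠ F.root x) :
    G.dist s x = F.height s + cycDist g (F.root s).val (F.root x).val + F.height x := by
  rw [F.dist_of_root_ne hG h, F.dist_vc hG hg hvc]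

lemma dist_le (hg : 3 ≤ g) (hvc : IsCycleLabelling G g vc) (s x : V) :
    G.dist s x ≤ F.height s + cycDist g (F.root s).val (F.root x).val + F.height x := by
  rw [← F.dist_vc hG hg hvc, ← F.dist_vc_root hG x, G.dist_comm (u := x)]
  exact hG.dist_triangle

end CycleForest

section Threads

variable {V : Type*} [Fintype V] {G : SimpleGraph V} [DecidableRel G.Adj]

/-- `t` satisfies the conditions for a thread hanging at `v`, except that `v` may have any
degree. -/
inductive HangingPath (G : SimpleGraph V) [DecidableRel G.Adj] : V → List V → Prop
  | leaf (v u : V) : G.Adj v u → G.degree u = 1 → HangingPath G v [u]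
  | cons (v u : V) (t : List V) : G.Adj v u → G.degree u = 2 → v ∉ t → HangingPath G u t →
      HangingPath G v (u :: t)

lemma HangingPath.exists_adj {v : V} {t : List V} (h : HangingPath G v t) :
    ∃ u ∈ t, G.Adj v u := by
  cases h with
  | leaf _ u h _ => exact ⟨u, by simp, h⟩
  | cons _ u t h _ hv _ => exact ⟨u, by simp, h⟩

lemma isThreadAt_iff [DecidableEq V] {v : V} {t : List V} :
    IsThreadAt G v t ↔ 3 ≤ G.degree v ∧ HangingPath G v t := by
  constructor
  · rintro ⟨hne, hnd, hv, hdeg, hch, hhd, hlast, hmid⟩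
    refine ⟨hdeg, ?_⟩
    clear hdeg
    change List.IsChain G.Adj t at hch
    induction t generalizing v with
    | nil => exact absurd rfl hne
    | cons u t ih =>
      have hvu : G.Adj v u := hhd u (by simp)
      cases t with
      | nil => exact .leaf v u hvu (hlast u (by simp))
      | cons w t =>
        rw [List.isChain_cons_cons] at hch
        rw [List.nodup_cons] at hnd
        refine .cons v u _ hvu (hmid u (by simp)) (fun h => hv (List.mem_cons_of_mem _ h))
          (ih (by simp) hnd.2 hnd.1 (by simpa using hch.1) ?_ ?_ hch.2)
        · simpa using hlast
        · exact fun x hx => hmid x (by rw [List.dropLast_cons_cons]; exact List.mem_cons_of_mem _ hx)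
  · rintro ⟨hdeg, h⟩
    suffices t ≠ [] ∧ t.Nodup ∧ v ∉ t ∧ List.IsChain G.Adj t ∧ (∀ u ∈ t.head?, G.Adj v u) ∧
        (∀ u ∈ t.getLast?, G.degree u = 1) ∧ ∀ u ∈ t.dropLast, G.degree u = 2 from
      ⟨this.1, this.2.1, this.2.2.1, hdeg, this.2.2.2⟩
    clear hdeg
    induction h with
    | leaf v u h hd => simp [h, hd, h.ne]
    | cons v u t h hd hv hp ih =>
      obtain ⟨hne, hnd, hu, hch, hhd, hlast, hmid⟩ := ih
      obtain ⟨w, t, rfl⟩ := List.exists_cons_of_ne_nil hne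
      refine ⟨by simp, List.nodup_cons.2 ⟨hu, hnd⟩, by simpa [h.ne] using hv,
        List.isChain_cons_cons.2 ⟨hhd w (by simp), hch⟩, by simpa using h, by simpa using hlast, ?_⟩
      rw [List.dropLast_cons_cons]
      simpa [hd] using hmid

lemma eq_or_eq_of_degree_eq_two {x a b y : V} (hx : G.degree x = 2) (ha : G.Adj x a)
    (hb : G.Adj x b) (hab : a ≠ b) (hy : G.Adj x y) : y = a ∨ y = b := by
  classical
  by_contra! h
  have : ({a, b, y} : Finset V) ⊆ G.neighborFinset x := by
    intro z; simp only [Finset.mem_insert, Finset.mem_singleton, mem_neighborFinset]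
    rintro (rfl | rfl | rfl) <;> assumption
  have := Finset.card_le_card this
  rw [Finset.card_eq_three.2 ⟨a, b, y, hab, h.1.symm, h.2.symm, rfl⟩,
    card_neighborFinset_eq_degree] at this
  omega

lemma three_le_degree {x a b c : V} (ha : G.Adj x a) (hb : G.Adj x b) (hc : G.Adj x c)
    (hab : a ≠ b) (hac : a ≠ c) (hbc : b ≠ c) : 3 ≤ G.degree x := by
  classical
  have : ({a, b, c} : Finset V) ⊆ G.neighborFinset x := by
    intro z; simp only [Finset.mem_insert, Finset.mem_singleton, mem_neighborFinset]
    rintro (rfl | rfl | rfl) <;> assumption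
  have := Finset.card_le_card this
  rwa [Finset.card_eq_three.2 ⟨a, b, c, hab, hac, hbc, rfl⟩,
    card_neighborFinset_eq_degree] at this

lemma eq_of_degree_eq_one {x a y : V} (hx : G.degree x = 1) (ha : G.Adj x a)
    (hy : G.Adj x y) : y = a := by
  rw [← card_neighborFinset_eq_degree] at hx
  exact Finset.card_le_one.1 hx.le y (by simpa) a (by simpa)

lemma HangingPath.eq_of_adj {v x y : V} {t : List V} (h : HangingPath G v t) (hx : x ∈ t)
    (hy : y ∉ t) (hxy : G.Adj x y) : y = v := by
  induction h with
  | leaf v u h hd =>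
    obtain rfl := List.mem_singleton.1 hx
    exact eq_of_degree_eq_one hd h.symm hxy
  | cons v u t h hd hv hp ih =>
    rw [List.mem_cons, not_or] at hy
    rcases List.mem_cons.1 hx with rfl | hx
    · obtain ⟨w, hw, hadj⟩ := hp.exists_adj
      rcases eq_or_eq_of_degree_eq_two hd h.symm hadj (fun e => hv (e ▸ hw)) hxy with h | rfl
      · exact h
      · exact absurd hw hy.2
    · exact absurd (ih hx hy.2) hy.1

lemma HangingPath.tail_unique {v u : V} {t₁ t₂ : List V} (h₁ : HangingPath G v (u :: t₁))
    (h₂ : HangingPath G v (u :: t₂)) : t₁ = t₂ := by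
  induction t₁ generalizing v u t₂ with
  | nil =>
    cases h₁ with
    | leaf _ _ h hd =>
      cases h₂ with
      | leaf _ _ _ _ => rfl
      | cons _ _ _ _ hd' _ _ => omega
    | cons _ _ _ _ _ _ hp => obtain ⟨w, hw, -⟩ := hp.exists_adj; simp at hw
  | cons w t₁ ih =>
    cases h₁ with
    | cons _ _ _ h hd hv hp =>
      cases h₂ with
      | leaf _ _ _ hd' => omega
      | cons _ _ _ _ hd' hv' hp' =>
        cases t₂ with
        | nil => obtain ⟨w, hw, -⟩ := hp'.exists_adj; simp at hw
        | cons w' t₂ =>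
          have hadj : ∀ {w t}, HangingPath G u (w :: t) → G.Adj u w := by
            rintro w t (⟨_, _, h, _⟩ | ⟨_, _, _, h, _⟩) <;> exact h
          rw [List.mem_cons, not_or] at hv hv'
          rcases eq_or_eq_of_degree_eq_two hd h.symm (hadj hp) hv.1 (hadj hp') with e | rfl
          · exact absurd e.symm hv'.1
          · rw [ih hp hp']

lemma HangingPath.dist_head (hG : G.Connected) {v u s : V} {t : List V}
    (h : HangingPath G v (u :: t)) (hs : s ∉ u :: t) : G.dist s u = G.dist s v + 1 := by
  have hadj : G.Adj v u := by cases h <;> assumption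
  rw [hG.dist_eq_of_cut (B := {z | z ∈ u :: t}) (w := v)
    (fun x hx z hz hxz => h.eq_of_adj hx hz hxz) hs (List.mem_cons_self (l := t)),
    dist_eq_one_iff_adj.2 hadj]

/-- The vertices along a hanging path, with their predecessors, and their distances to the
outside. -/
lemma HangingPath.exists_dist_eq (hG : G.Connected) {v : V} {t : List V} (h : HangingPath G v t)
    {p : ℕ} (hp : p < t.length) : ∃ x ∈ t, ∃ y, G.Adj x y ∧ ∀ s ∉ t,
      G.dist s x = G.dist s v + p + 1 ∧ G.dist s y = G.dist s v + p := by
  induction h generalizing p with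
  | leaf v u h hd =>
    obtain rfl : p = 0 := by simpa using hp
    exact ⟨u, by simp, v, h.symm, fun s hs => ⟨(HangingPath.leaf v u h hd).dist_head hG hs, rfl⟩⟩
  | cons v u t h hd hv hp' ih =>
    have hd' := fun s => (HangingPath.cons v u t h hd hv hp').dist_head (s := s) hG
    cases p with
    | zero => exact ⟨u, by simp, v, h.symm, fun s hs => ⟨hd' s hs, rfl⟩⟩
    | succ p =>
      obtain ⟨x, hx, y, hxy, hdist⟩ := ih (by simpa using hp)
      refine ⟨x, List.mem_cons_of_mem _ hx, y, hxy, fun s hs => ?_⟩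
      have h1 := hd' s hs
      have h2 := hdist s fun h => hs (List.mem_cons_of_mem _ h)
      omega

lemma ZMod.add_one_ne_sub_one {g : ℕ} (hg : 3 ≤ g) (j : ZMod g) : j + 1 ≠ j - 1 := fun e =>
  ZMod.natCast_ne_zero_of_lt (g := g) (m := 2) (by omega) (by omega)
    (by push_cast; linear_combination e)

omit [Fintype V] [DecidableRel G.Adj] in
lemma IsCycleLabelling.adj_sub_one {g : ℕ} {vc : ZMod g → V} (hvc : IsCycleLabelling G g vc)
    (j : ZMod g) : G.Adj (vc j) (vc (j - 1)) := by
  simpa using (hvc.2 (j - 1)).symm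

lemma HangingPath.ne_vc {g : ℕ} {vc : ZMod g → V} (hg : 3 ≤ g) (hvc : IsCycleLabelling G g vc)
    {v x : V} {t : List V} (h : HangingPath G v t) (hx : x ∈ t) (j : ZMod g) : x ≠ vc j := by
  have hne : ∀ j, vc (j + 1) ≠ vc (j - 1) := fun j e => ZMod.add_one_ne_sub_one hg j (hvc.1 e)
  induction h generalizing x j with
  | leaf v u h hd =>
    obtain rfl := List.mem_singleton.1 hx
    rintro rfl
    exact hne j (eq_of_degree_eq_one hd (hvc.adj_sub_one j) (hvc.2 j))
  | cons v u t h hd hv hp ih =>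
    rcases List.mem_cons.1 hx with rfl | hx
    · rintro rfl
      obtain ⟨w, hw, hadj⟩ := hp.exists_adj
      rcases eq_or_eq_of_degree_eq_two hd (hvc.2 j) (hvc.adj_sub_one j) (hne j) hadj with h | h
      exacts [ih hw _ h, ih hw _ h]
    · exact ih hx j

end Threads

namespace CycleForest

variable {V : Type*} {G : SimpleGraph V} {g : ℕ} {vc : ZMod g → V} (F : CycleForest G g vc)

lemma Desc.of_par_eq {F : CycleForest G g vc} {a c x : V} (h : F.Desc c x) (hc : F.par c = a) :
    F.Desc a x := by
  obtain ⟨n, rfl⟩ := h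
  exact ⟨n + 1, by rw [Function.iterate_succ_apply', hc]⟩

lemma Desc.trans {F : CycleForest G g vc} {a b x : V} (h : F.Desc a b) (h' : F.Desc b x) :
    F.Desc a x := by
  obtain ⟨n, rfl⟩ := h
  obtain ⟨m, rfl⟩ := h'
  exact ⟨n + m, Function.iterate_add_apply _ _ _ _⟩

lemma Desc.eq_or_child {F : CycleForest G g vc} {a x : V} (h : F.Desc a x) :
    x = a ∨ ∃ c, F.par c = a ∧ F.Desc c x := by
  obtain ⟨n, hn⟩ := h
  cases n with
  | zero => exact Or.inl hn
  | succ n => exact Or.inr ⟨_, by rwa [Function.iterate_succ_apply'] at hn, n, rfl⟩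

lemma height_child {a c : V} (ha : 0 < F.height a) (hc : F.par c = a) :
    F.height c = F.height a + 1 := by
  have := F.height_par' c
  rw [hc] at this
  omega

variable [Fintype V] [DecidableRel G.Adj] [DecidableEq V]

/-- A subtree avoiding a branch-resolving set is a path. -/
lemma exists_hangingPath {S : Set V} (hS : BranchResolving G S) {a : V} (ha : 0 < F.height a)
    (hfree : ∀ s ∈ S, ¬ F.Desc a s) : ∃ t, HangingPath G (F.par a) t ∧
      (∀ x, x ∈ t ↔ F.Desc a x) ∧ ∀ x ∈ t, F.height x + 1 ≤ F.height a + t.length := by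
  obtain ⟨k, hk⟩ : ∃ k, Finset.univ.sup F.height < F.height a + k :=
    ⟨_, Nat.lt_of_lt_of_le (Nat.lt_succ_self _) (Nat.le_add_left _ _)⟩
  induction k generalizing a with
  | zero =>
    have := Finset.le_sup (f := F.height) (Finset.mem_univ a)
    omega
  | succ k ih =>
    have hchild : ∀ c, F.par c = a → 0 < F.height c ∧ F.height c = F.height a + 1 ∧ G.Adj a c ∧
        c ≠ F.par a := by
      intro c hc
      have h1 := F.height_child ha hc
      have h2 := F.height_par a ha
      refine ⟨by omega, h1, hc ▸ F.par_adj c (by omega), fun h => ?_⟩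
      rw [h] at h1
      omega
    have hnbr : ∀ y, G.Adj a y → y = F.par a ∨ F.par y = a := by
      intro y hy
      rcases F.adj_cases a y hy with ⟨-, h⟩ | ⟨-, h⟩ | ⟨h, -⟩
      · exact Or.inl h
      · exact Or.inr h.symm
      · omega
    have hrec : ∀ c, F.par c = a → ∃ t, HangingPath G a t ∧
        (∀ x, x ∈ t ↔ F.Desc c x) ∧ ∀ x ∈ t, F.height x + 1 ≤ F.height c + t.length := by
      intro c hc
      have := ih (hchild c hc).1 (fun s hs h => hfree s hs (h.of_par_eq hc))
        (by have := (hchild c hc).2.1; omega)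
      rwa [hc] at this
    have hpar := F.par_adj a ha
    by_cases h0 : ∃ c, F.par c = a
    · obtain ⟨c, hc⟩ := h0
      obtain ⟨t, ht, hmem, hlen⟩ := hrec c hc
      obtain ⟨-, hch, hac, hcp⟩ := hchild c hc
      have huniq : ∀ c', F.par c' = a → c' = c := by
        intro c' hc'
        by_contra hne
        obtain ⟨t', ht', hmem', -⟩ := hrec c' hc'
        have hdeg := three_le_degree hpar.symm hac (hchild c' hc').2.2.1 hcp.symm
          (hchild c' hc').2.2.2.symm (Ne.symm hne)
        rcases hS a t t' (isThreadAt_iff.2 ⟨hdeg, ht⟩) (isThreadAt_iff.2 ⟨hdeg, ht'⟩) (by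
          rintro rfl
          have := (hmem c').1 ((hmem' c').2 (F.desc_refl _))
          have h2 := (hchild c' hc')
          exact hne (F.desc_refl c' |>.unique this (by omega) h2.1)) with
          ⟨s, hs, hst⟩ | ⟨s, hs, hst⟩
        · exact hfree s hs (((hmem s).1 hst).of_par_eq hc)
        · exact hfree s hs (((hmem' s).1 hst).of_par_eq hc')
      have hdeg : G.degree a = 2 := by
        rw [← card_neighborFinset_eq_degree, Finset.card_eq_two]
        refine ⟨F.par a, c, hcp.symm, ?_⟩
        ext y
        simp only [mem_neighborFinset, Finset.mem_insert, Finset.mem_singleton]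
        refine ⟨fun h => (hnbr y h).imp_right (huniq y), ?_⟩
        rintro (rfl | rfl)
        exacts [hpar.symm, hac]
      refine ⟨a :: t, .cons _ _ _ hpar hdeg (fun h => ?_) ht, fun x => ?_, fun x hx => ?_⟩
      · have := ((hmem _).1 h).height_le
        have := F.height_par a ha
        omega
      · rw [List.mem_cons, hmem]
        constructor
        · rintro (rfl | h)
          exacts [F.desc_refl _, h.of_par_eq hc]
        · intro h
          refine h.eq_or_child.imp_right ?_
          rintro ⟨c', hc', h⟩
          exact huniq c' hc' ▸ h
      · rw [List.length_cons]
        rcases List.mem_cons.1 hx with rfl | hx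
        · omega
        · have := hlen x hx
          omega
    · push Not at h0
      have hdeg : G.degree a = 1 := by
        rw [← card_neighborFinset_eq_degree, Finset.card_eq_one]
        refine ⟨F.par a, ?_⟩
        ext y
        simp only [mem_neighborFinset, Finset.mem_singleton]
        refine ⟨fun h => (hnbr y h).resolve_right (h0 y), ?_⟩
        rintro rfl
        exact hpar.symm
      refine ⟨[a], .leaf _ _ hpar hdeg, fun x => ?_, by simp⟩
      rw [List.mem_singleton]
      constructor
      · rintro rfl; exact F.desc_refl _
      · intro h
        rcases h.eq_or_child with h | ⟨c, hc, -⟩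
        exacts [h, absurd hc (h0 c)]

lemma exists_thread_of_height_pos (hg : 3 ≤ g) (hvc : IsCycleLabelling G g vc) {S : Set V}
    (hS : BranchResolving G S) {x : V} (hx : 0 < F.height x)
    (hfree : ∀ s ∈ S, ¬ F.Desc (F.top x) s) :
    ∃ t, IsThreadAt G (vc (F.root x)) t ∧ SFree S t ∧ F.height x ≤ t.length := by
  have htop := F.height_top hx
  obtain ⟨t, ht, hmem, hlen⟩ := F.exists_hangingPath hS (a := F.top x) (by omega) hfree
  have hadj := F.par_adj (F.top x) (by omega)
  rw [F.par_top hx] at ht hadj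
  refine ⟨t, isThreadAt_iff.2 ⟨?_, ht⟩, fun u hu hus => hfree u hus ((hmem u).1 hu), ?_⟩
  · refine three_le_degree (hvc.2 _) (hvc.adj_sub_one _) hadj
      (fun e => ZMod.add_one_ne_sub_one hg _ (hvc.1 e)) ?_ ?_ <;>
    · intro e
      rw [← e, F.height_vc] at htop
      omega
  · have := hlen x ((hmem x).2 (F.desc_top x))
    omega

lemma exists_of_height_eq (hG : G.Connected) (hvc : IsCycleLabelling G g vc)
    {S : Set V} (hS : BranchResolving G S) {x y : V} (hxy : x ≠ y) (hroot : F.root x = F.root y)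
    (hheight : F.height x = F.height y) :
    ∃ s ∈ S, (G.dist s x + 2 ≤ G.dist s y ∧ ¬ F.Desc y s) ∨
      (G.dist s y + 2 ≤ G.dist s x ∧ ¬ F.Desc x s) := by
  classical
  have hex : ∃ n, F.par^[n] x = F.par^[n] y :=
    ⟨F.height x, by rw [F.iterate_height, hheight, F.iterate_height, hroot]⟩
  obtain ⟨m, hm⟩ : ∃ m, Nat.find hex = m + 1 := Nat.exists_eq_succ_of_ne_zero fun h => hxy <| by
    simpa [h] using Nat.find_spec hex
  have hne : F.par^[m] x ≠ F.par^[m] y := Nat.find_min hex (by omega)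
  have heq := Nat.find_spec hex
  rw [hm, Function.iterate_succ_apply', Function.iterate_succ_apply'] at heq
  set a := F.par^[m] x with ha
  set b := F.par^[m] y with hb
  have hax : F.Desc a x := ⟨m, rfl⟩
  have hby : F.Desc b y := ⟨m, rfl⟩
  have hab : F.height a = F.height b := by rw [ha, hb, height_iterate, height_iterate, hheight]
  have ha0 : 0 < F.height a := by
    by_contra h
    rw [F.par_of_height a (by omega), F.par_of_height b (by omega)] at heq
    exact hne heq
  have key : ∀ {a b x y s : V}, F.Desc a x → F.Desc b y → F.height a = F.height b →
      0 < F.height a → a ≠ b → F.par a = F.par b → F.height x = F.height y → F.Desc a s →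
      G.dist s x + 2 ≤ G.dist s y ∧ ¬ F.Desc y s := by
    intro a b x y s hax hby hab ha0 hne heq hxy hs
    have hnb : ¬ F.Desc b s := fun h => hne (hs.unique h hab ha0)
    refine ⟨?_, fun h => hnb (hby.trans h)⟩
    have h1 := F.dist_of_not_desc hG (by omega) hby hnb
    have h2 := (hs.of_par_eq rfl).dist_add hG
    have h3 := hs.dist_add hG
    have h4 := hax.dist_add hG
    have h5 := hG.dist_triangle (u := s) (v := a) (w := x)
    have h6 := F.height_par a ha0
    rw [← heq, G.dist_comm (u := s) (v := F.par a)] at h1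
    rw [G.dist_comm (u := s) (v := a)] at h5
    omega
  by_cases h1 : ∃ s ∈ S, F.Desc a s
  · obtain ⟨s, hs, has⟩ := h1
    exact ⟨s, hs, Or.inl (key hax hby hab ha0 hne heq hheight has)⟩
  by_cases h2 : ∃ s ∈ S, F.Desc b s
  · obtain ⟨s, hs, hbs⟩ := h2
    exact ⟨s, hs, Or.inr (key hby hax hab.symm (by omega) hne.symm heq.symm hheight.symm hbs)⟩
  push Not at h1 h2
  obtain ⟨t₁, ht₁, hmem₁, -⟩ := F.exists_hangingPath hS ha0 h1
  obtain ⟨t₂, ht₂, hmem₂, -⟩ := F.exists_hangingPath hS (by omega) h2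
  have hadja := F.par_adj a ha0
  have hadjb := F.par_adj b (by omega)
  rw [← heq] at ht₂ hadjb
  have hdeg : 3 ≤ G.degree (F.par a) := by
    have hpa := F.height_par a ha0
    rcases Nat.eq_zero_or_pos (F.height (F.par a)) with h0 | h0
    · have h := F.eq_vc _ h0
      rw [h] at hadja hadjb ⊢
      refine three_le_degree (hvc.2 _) hadja hadjb ?_ ?_ hne <;>
      · intro e
        have := F.height_vc (F.root (F.par a) + 1)
        rw [e] at this
        omega
    · have hpp := F.height_par _ h0
      refine three_le_degree (F.par_adj _ h0).symm hadja hadjb ?_ ?_ hne <;>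
      · intro e
        rw [e] at hpp
        omega
  exfalso
  rcases hS _ t₁ t₂ (isThreadAt_iff.2 ⟨hdeg, ht₁⟩) (isThreadAt_iff.2 ⟨hdeg, ht₂⟩) (by
    rintro rfl
    exact hne ((F.desc_refl a).unique ((hmem₂ a).1 ((hmem₁ a).2 (F.desc_refl a))) hab ha0)) with
    ⟨s, hs, hst⟩ | ⟨s, hs, hst⟩
  · exact h1 s hs ((hmem₁ s).1 hst)
  · exact h2 s hs ((hmem₂ s).1 hst)

end CycleForest

section Labellings

variable {V : Type*} {G : SimpleGraph V} {g : ℕ} {vc : ZMod g → V} {S : Set V}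

lemma IsCycleLabelling.rotate (hvc : IsCycleLabelling G g vc) (c : ZMod g) :
    IsCycleLabelling G g (fun i => vc (c + i)) :=
  ⟨fun _ _ h => add_left_cancel (hvc.1 h), fun i => by
    simpa [add_assoc] using hvc.2 (c + i)⟩

lemma range_rotate (c : ZMod g) : Set.range (fun i => vc (c + i)) = Set.range vc :=
  (Equiv.addLeft c).surjective.range_comp vc

lemma cycleEdges_rotate (c : ZMod g) : cycleEdges g (fun i => vc (c + i)) = cycleEdges g vc := by
  ext e
  constructor
  · rintro ⟨i, rfl⟩
    exact ⟨c + i, by rw [add_assoc]⟩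
  · rintro ⟨i, rfl⟩
    exact ⟨i - c, by simp [← add_assoc]⟩

lemma sActive_rotate (c i : ZMod g) :
    SActive G g (fun i => vc (c + i)) S i ↔ SActive G g vc S (c + i) := by
  simp only [SActive, inTree, offCycle, cycleEdges_rotate]

lemma bddAbove_active : BddAbove {n : ℕ | n < g ∧ SActive G g vc S (n : ZMod g)} :=
  ⟨g, fun _ h => h.1.le⟩

lemma le_kOf {n : ℕ} (hn : n < g) (h : SActive G g vc S (n : ZMod g)) : n ≤ kOf G g vc S :=
  le_csSup bddAbove_active ⟨hn, h⟩

lemma kOf_mem (hg : 0 < g) (h : SActive G g vc S 0) :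
    kOf G g vc S < g ∧ SActive G g vc S (kOf G g vc S : ZMod g) :=
  Nat.sSup_mem (s := {n : ℕ | n < g ∧ SActive G g vc S (n : ZMod g)}) ⟨0, hg, by simpa⟩
    bddAbove_active

lemma exists_canonical (hvc : IsCycleLabelling G g vc) {i : ZMod g} (hi : SActive G g vc S i) :
    ∃ vc', IsCycleLabelling G g vc' ∧ Set.range vc' = Set.range vc ∧ Canonical G g vc' S := by
  classical
  have hex : ∃ n, ∃ vc', IsCycleLabelling G g vc' ∧ Set.range vc' = Set.range vc ∧
      SActive G g vc' S 0 ∧ kOf G g vc' S = n :=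
    ⟨_, _, hvc.rotate i, range_rotate i, (sActive_rotate i 0).2 (by simpa), rfl⟩
  obtain ⟨vc', h1, h2, h3, h4⟩ := Nat.find_spec hex
  refine ⟨vc', h1, h2, h1, h3, fun vc'' h1' h2' h3' => ?_⟩
  rw [h4]
  exact Nat.find_min' hex ⟨vc'', h1', h2'.trans h2, h3', rfl⟩

namespace CycleForest

variable (F : CycleForest G g vc)

lemma sActive_iff {i : ZMod g} : SActive G g vc S i ↔ ∃ s ∈ S, F.root s = i := by
  simp only [SActive, F.inTree_iff]

lemma biactive_iff [NeZero g] :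
    Biactive G g vc S ↔ ∃ s ∈ S, ∃ s' ∈ S, F.root s ≠ F.root s' := by
  have : Biactive G g vc S ↔ 1 < (F.root '' S).ncard := by
    have : {i : ZMod g | SActive G g vc S i} = F.root '' S := by ext i; exact F.sActive_iff
    rw [Biactive, aS, this]
    rfl
  rw [this, Set.one_lt_ncard_iff]
  constructor
  · rintro ⟨_, _, ⟨s, hs, rfl⟩, ⟨s', hs', rfl⟩, h⟩
    exact ⟨s, hs, s', hs', h⟩
  · rintro ⟨s, hs, s', hs', h⟩
    exact ⟨_, _, ⟨s, hs, rfl⟩, ⟨s', hs', rfl⟩, h⟩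

include F in
lemma cycleEdges_subset {vc' : ZMod g → V} (hvc' : IsCycleLabelling G g vc')
    (hr : Set.range vc' = Set.range vc) : cycleEdges g vc' ⊆ cycleEdges g vc := by
  have key : ∀ i, ∃ j, vc j = vc' i := fun i => by
    simpa [hr] using Set.mem_range_self (f := vc') i
  rintro _ ⟨i, rfl⟩
  obtain ⟨a, ha⟩ := key i
  obtain ⟨b, hb⟩ := key (i + 1)
  have h := hvc'.2 i
  rw [← ha, ← hb] at h ⊢
  rcases F.adj_cases _ _ h with ⟨h, -⟩ | ⟨h, -⟩ | ⟨-, -, h⟩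
  · simp [height_vc] at h
  · simp [height_vc] at h
  · simp only [root_vc] at h
    rcases h with rfl | rfl
    exacts [⟨_, rfl⟩, ⟨_, Sym2.eq_swap⟩]

lemma root_eq_root_iff {s s' : V} :
    F.root s = F.root s' ↔ (offCycle G g vc).Reachable s s' := by
  have h1 := (F.inTree_iff (F.root s) s).2 rfl
  refine ⟨fun h => h1.symm.trans ((F.inTree_iff _ _).2 h.symm), fun h => ?_⟩
  exact ((F.inTree_iff _ _).1 (h1.trans h)).symm

include F in
lemma biactive_of_range_eq [NeZero g] {vc' : ZMod g → V} (F' : CycleForest G g vc')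
    (hvc : IsCycleLabelling G g vc) (hvc' : IsCycleLabelling G g vc')
    (hr : Set.range vc' = Set.range vc) (h : Biactive G g vc S) : Biactive G g vc' S := by
  have he : cycleEdges g vc' = cycleEdges g vc :=
    (F.cycleEdges_subset hvc' hr).antisymm (F'.cycleEdges_subset hvc hr.symm)
  rw [F'.biactive_iff]
  obtain ⟨s, hs, s', hs', h⟩ := F.biactive_iff.1 h
  refine ⟨s, hs, s', hs', ?_⟩
  rwa [Ne, F'.root_eq_root_iff, offCycle, he, ← offCycle, ← F.root_eq_root_iff]

lemma val_le_kOf [NeZero g] {s : V} (hs : s ∈ S) : (F.root s).val ≤ kOf G g vc S :=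
  le_kOf (F.root s).val_lt (by rw [ZMod.natCast_zmod_val]; exact F.sActive_iff.2 ⟨s, hs, rfl⟩)

lemma exists_val_eq_zero (h : Canonical G g vc S) : ∃ s ∈ S, (F.root s).val = 0 := by
  obtain ⟨s, hs, h⟩ := F.sActive_iff.1 h.2.1
  exact ⟨s, hs, by simp [h]⟩

lemma exists_val_eq_kOf (hg : 0 < g) (h : Canonical G g vc S) :
    ∃ s ∈ S, (F.root s).val = kOf G g vc S := by
  obtain ⟨hk, h⟩ := kOf_mem hg h.2.1
  obtain ⟨s, hs, h⟩ := F.sActive_iff.1 h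
  exact ⟨s, hs, by rw [h, ZMod.val_natCast_of_lt hk]⟩

/-- If all active vertices lie on an arc with `K` edges, then `k ≤ K`. -/
lemma kOf_le_of_arc [NeZero g] (h : Canonical G g vc S) {c K : ℕ} (hc : c < g)
    (hK : ∀ s ∈ S, c ≤ (F.root s).val ∧ (F.root s).val ≤ c + K ∨ (F.root s).val + g ≤ c + K) :
    kOf G g vc S ≤ K := by
  classical
  have off : ∀ i : ZMod g, ((c : ZMod g) + i).val = c + i.val ∨
      ((c : ZMod g) + i).val + g = c + i.val := by
    intro i
    have h1 := ZMod.val_natCast_of_lt hc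
    rcases lt_or_ge ((c : ZMod g).val + i.val) g with h | h
    · left; rw [ZMod.val_add_of_lt h, h1]
    · right
      have := ZMod.val_add_val_of_le h
      omega
  have hex : ∃ n, SActive G g vc S (c + (n : ℕ)) := by
    refine ⟨(0 - (c : ZMod g)).val, ?_⟩
    rw [ZMod.natCast_zmod_val]
    simpa using h.2.1
  set m := Nat.find hex with hm
  have hkm := h.2.2 _ (h.1.rotate (c + (m : ℕ))) (range_rotate _)
    ((sActive_rotate _ _).2 (by simpa using Nat.find_spec hex))
  refine hkm.trans ?_
  have hg : 0 < g := Nat.pos_of_ne_zero (NeZero.ne g)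
  obtain ⟨hlt, hact⟩ := kOf_mem hg
    ((sActive_rotate (vc := vc) (G := G) (S := S) (c + (m : ℕ)) 0).2
      (by simpa using Nat.find_spec hex))
  set k' := kOf G g (fun i => vc (c + (m : ℕ) + i)) S
  rw [sActive_rotate, F.sActive_iff] at hact
  obtain ⟨s, hs, hroot⟩ := hact
  have hmg : m < g := by
    have := Nat.find_min' hex (m := (0 - (c : ZMod g)).val) (by
      rw [ZMod.natCast_zmod_val]
      simpa using h.2.1)
    exact this.trans_lt (ZMod.val_lt _)
  have hmin : m ≤ (F.root s - c).val := Nat.find_min' hex (by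
    rw [ZMod.natCast_zmod_val, add_sub_cancel]
    exact F.sActive_iff.2 ⟨s, hs, rfl⟩)
  have h1 := hK s hs
  have h2 := ZMod.val_sub_cases (F.root s) c
  rw [ZMod.val_natCast_of_lt hc] at h2
  have h3 : F.root s - c = (m : ℕ) + (k' : ℕ) := by rw [hroot]; ring
  have h4 : (F.root s - c).val = m + k' ∨ (F.root s - c).val + g = m + k' := by
    rw [h3]
    have e1 := ZMod.val_natCast_of_lt hmg
    have e2 := ZMod.val_natCast_of_lt hlt
    rcases lt_or_ge ((m : ZMod g).val + (k' : ZMod g).val) g with h | h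
    · left; rw [ZMod.val_add_of_lt h, e1, e2]
    · right
      have := ZMod.val_add_val_of_le h
      omega
  have := (F.root s).val_lt
  have := (F.root s - c).val_lt
  omega

lemma aS_eq_two_iff (hg : 3 ≤ g) (h : Canonical G g vc S) : aS G g vc S = 2 ↔
    0 < kOf G g vc S ∧ ∀ s ∈ S, (F.root s).val = 0 ∨ (F.root s).val = kOf G g vc S := by
  have : NeZero g := ⟨by omega⟩
  have hk := (kOf_mem (by omega) h.2.1).1
  have hset : {i : ZMod g | SActive G g vc S i} = F.root '' S := by ext i; exact F.sActive_iff
  rw [aS, hset]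
  have hsub : {0, (kOf G g vc S : ZMod g)} ⊆ F.root '' S := by
    rw [← hset]
    rintro i (rfl | rfl)
    exacts [h.2.1, (kOf_mem (by omega) h.2.1).2]
  have hval : ∀ i : ZMod g, i ∈ ({0, (kOf G g vc S : ZMod g)} : Set (ZMod g)) ↔
      i.val = 0 ∨ i.val = kOf G g vc S := by
    intro i
    rw [Set.mem_insert_iff, Set.mem_singleton_iff, ZMod.val_eq_zero]
    refine or_congr_right ⟨fun h => by rw [h, ZMod.val_natCast_of_lt hk], fun h => ?_⟩
    rw [← h, ZMod.natCast_zmod_val]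
  constructor
  · intro hcard
    have hk0 : 0 < kOf G g vc S := by
      by_contra h0
      have : F.root '' S ⊆ {0} := by
        rintro _ ⟨s, hs, rfl⟩
        have := F.val_le_kOf hs
        rw [Set.mem_singleton_iff, ← ZMod.val_eq_zero]
        omega
      have := Set.ncard_le_ncard this
      rw [Set.ncard_singleton] at this
      omega
    refine ⟨hk0, fun s hs => ?_⟩
    rw [← hval, Set.eq_of_subset_of_ncard_le hsub (by
      rw [hcard, Set.ncard_pair (ZMod.natCast_ne_zero_of_lt hk0 hk).symm])]
    exact ⟨s, hs, rfl⟩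
  · rintro ⟨hk0, hS⟩
    rw [← Set.ncard_pair (ZMod.natCast_ne_zero_of_lt hk0 hk).symm]
    congr 1
    refine Set.Subset.antisymm ?_ hsub
    rintro _ ⟨s, hs, rfl⟩
    exact (hval _).2 (hS s hs)

include F in
lemma kOf_le_half (hg : 3 ≤ g) (h : Canonical G g vc S) (h2 : aS G g vc S = 2) :
    kOf G g vc S ≤ g / 2 := by
  have : NeZero g := ⟨by omega⟩
  have hk := (kOf_mem (by omega) h.2.1).1
  have := F.kOf_le_of_arc h (c := kOf G g vc S) (K := g - kOf G g vc S) hk (fun s hs => by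
    have := ((F.aS_eq_two_iff hg h).1 h2).2 s hs
    omega)
  omega

end CycleForest

end Labellings

section Necessity

variable {V : Type*} {G : SimpleGraph V} {S : Set V}

@[simp] lemma edgeDist_mk (s u w : V) : edgeDist G s s(u, w) = min (G.dist s u) (G.dist s w) := rfl

lemma eq_of_twin (hS : IsVertexMG G S ∨ IsEdgeMG G S) {v x y : V} (hx : G.Adj v x)
    (hy : G.Adj v y) (h : ∀ s ∈ S, G.dist s x = G.dist s y) : x = y := by
  by_contra hne
  rcases hS with hS | hS
  · obtain ⟨s, hs, hd⟩ := hS x y hne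
    exact hd (h s hs)
  · obtain ⟨s, hs, hd⟩ := hS s(v, x) hx s(v, y) hy fun h => hne (Sym2.congr_right.1 h)
    exact hd (by simp [h s hs])

lemma branchResolving_of_isMG [Fintype V] [DecidableEq V] [DecidableRel G.Adj] (hG : G.Connected)
    (hS : IsVertexMG G S ∨ IsEdgeMG G S) : BranchResolving G S := by
  intro v t₁ t₂ h₁ h₂ hne
  by_contra! h
  obtain ⟨hf₁, hf₂⟩ := h
  have h₁' := (isThreadAt_iff.1 h₁).2
  have h₂' := (isThreadAt_iff.1 h₂).2
  obtain ⟨u₁, t₁, rfl⟩ := List.exists_cons_of_ne_nil h₁.1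
  obtain ⟨u₂, t₂, rfl⟩ := List.exists_cons_of_ne_nil h₂.1
  have hadj : ∀ {u t}, HangingPath G v (u :: t) → G.Adj v u := by
    rintro u t (⟨_, _, h, _⟩ | ⟨_, _, _, h, _⟩) <;> exact h
  obtain rfl : u₁ = u₂ := eq_of_twin hS (hadj h₁') (hadj h₂') fun s hs => by
    rw [h₁'.dist_head hG (hf₁ s hs), h₂'.dist_head hG (hf₂ s hs)]
  exact hne (by rw [h₁'.tail_unique h₂'])

lemma ZMod.val_sub_one_cases {g : ℕ} (hg : 3 ≤ g) (a : ZMod g) :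
    (a - 1).val + 1 = a.val ∨ ((a - 1).val + 1 = g ∧ a.val = 0) := by
  have := ZMod.val_add_one_cases hg (a - 1)
  rw [sub_add_cancel] at this
  omega

namespace CycleForest

variable {g : ℕ} {vc : ZMod g → V} (F : CycleForest G g vc)

include F in
lemma biactive_of_isMG (hG : G.Connected) (hg : 3 ≤ g) (hvc : IsCycleLabelling G g vc)
    (hS : IsVertexMG G S ∨ IsEdgeMG G S) : Biactive G g vc S := by
  have : NeZero g := ⟨by omega⟩
  rw [F.biactive_iff]
  by_contra! h
  obtain ⟨a, ha⟩ : ∃ a, ∀ s ∈ S, F.root s = a := by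
    rcases S.eq_empty_or_nonempty with rfl | ⟨s, hs⟩
    · exact ⟨0, by simp⟩
    · exact ⟨F.root s, fun s' hs' => h s' hs' s hs⟩
  refine ZMod.add_one_ne_sub_one hg a (hvc.1 (eq_of_twin hS (hvc.2 a) (hvc.adj_sub_one a) ?_))
  intro s hs
  rw [F.dist_vc hG hg hvc, F.dist_vc hG hg hvc, ha s hs]
  have := ZMod.val_add_one_cases hg a
  have := ZMod.val_sub_one_cases hg a
  have := a.val_lt
  unfold cycDist
  omega

include F in
lemma not_configA (hG : G.Connected) (hg : 3 ≤ g) (hvc : IsCycleLabelling G g vc)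
    (hcan : Canonical G g vc S) (hS : IsVertexMG G S ∨ IsEdgeMG G S) : ¬ ConfigA G g vc S := by
  rintro ⟨h2, ⟨r, hr⟩, hk⟩
  have h := ((F.aS_eq_two_iff hg hcan).1 h2).2
  refine ZMod.add_one_ne_sub_one hg 0 (hvc.1 (eq_of_twin hS (hvc.2 0) (hvc.adj_sub_one 0) ?_))
  intro s hs
  rw [F.dist_vc hG hg hvc, F.dist_vc hG hg hvc]
  have h1 := ZMod.val_add_one_cases hg 0
  have h2 := ZMod.val_sub_one_cases hg 0
  have h3 := h s hs
  rw [ZMod.val_zero] at h1 h2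
  unfold cycDist
  omega

variable [Fintype V] [DecidableEq V] [DecidableRel G.Adj]

lemma exists_thread_edge (hG : G.Connected) (hg : 3 ≤ g) (hvc : IsCycleLabelling G g vc) {i : ℕ}
    (hi : i < g) {t : List V} (ht : IsThreadAt G (vc i) t) (hfree : SFree S t) {p : ℕ}
    (hp : p < t.length) : ∃ x y, G.Adj x y ∧ (∀ j, x ≠ vc j) ∧ ∀ s ∈ S,
      G.dist s x = F.height s + cycDist g (F.root s).val i + p + 1 ∧
      G.dist s y = F.height s + cycDist g (F.root s).val i + p := by
  have ht := (isThreadAt_iff.1 ht).2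
  obtain ⟨x, hx, y, hxy, h⟩ := ht.exists_dist_eq hG hp
  refine ⟨x, y, hxy, ht.ne_vc hg hvc hx, fun s hs => ?_⟩
  have := h s fun hst => hfree s hst hs
  rwa [F.dist_vc hG hg hvc, ZMod.val_natCast_of_lt hi] at this

lemma not_isVertexMG_of_thread (hG : G.Connected) (hg : 3 ≤ g) (hvc : IsCycleLabelling G g vc)
    {i j p : ℕ} (hi : i < g) (hj : j < g) {t : List V} (ht : IsThreadAt G (vc i) t)
    (hfree : SFree S t) (hp : p < t.length) (h : ∀ s ∈ S,
      cycDist g (F.root s).val i + p + 1 = cycDist g (F.root s).val j) : ¬ IsVertexMG G S := by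
  intro hS
  obtain ⟨x, y, -, hne, hx⟩ := F.exists_thread_edge hG hg hvc hi ht hfree hp
  obtain ⟨s, hs, hd⟩ := hS x (vc j) (hne j)
  have h1 := hx s hs
  have h2 := h s hs
  have h3 := F.dist_vc hG hg hvc s j
  rw [ZMod.val_natCast_of_lt hj] at h3
  omega

lemma not_isEdgeMG_of_thread (hG : G.Connected) (hg : 3 ≤ g) (hvc : IsCycleLabelling G g vc)
    {i j j' p : ℕ} (hi : i < g) (hj : j < g) (hj' : j' < g) (hjj' : j' = j + 1 ∨ j' + g = j + 1)
    {t : List V} (ht : IsThreadAt G (vc i) t) (hfree : SFree S t) (hp : p < t.length)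
    (h : ∀ s ∈ S, cycDist g (F.root s).val i + p =
      min (cycDist g (F.root s).val j) (cycDist g (F.root s).val j')) : ¬ IsEdgeMG G S := by
  intro hS
  obtain ⟨x, y, hxy, hne, hx⟩ := F.exists_thread_edge hG hg hvc hi ht hfree hp
  have he : (j' : ZMod g) = j + 1 := by
    rcases hjj' with rfl | h
    · push_cast; rfl
    · simpa using congrArg (Nat.cast : ℕ → ZMod g) h
  obtain ⟨s, hs, hd⟩ := hS s(x, y) hxy s(vc j, vc j') (he ▸ hvc.2 j) (by
    rw [Ne, Sym2.eq_iff]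
    rintro (⟨h, -⟩ | ⟨h, -⟩) <;> exact hne _ h)
  have h1 := hx s hs
  have h2 := h s hs
  have h3 := F.dist_vc hG hg hvc s j
  have h4 := F.dist_vc hG hg hvc s j'
  rw [ZMod.val_natCast_of_lt hj] at h3
  rw [ZMod.val_natCast_of_lt hj'] at h4
  rw [edgeDist_mk, edgeDist_mk] at hd
  omega

include F in
lemma not_configB (hG : G.Connected) (hg : 3 ≤ g) (heven : Even g) (hvc : IsCycleLabelling G g vc)
    (hS : IsVertexMG G S) : ¬ ConfigB G g vc S := by
  have : NeZero g := ⟨by omega⟩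
  rintro ⟨hk, i, hi, t, ht, hfree⟩
  have hlen := List.length_pos_of_ne_nil ht.1
  obtain ⟨r, rfl⟩ := heven
  rcases hi with hi | hi
  · refine F.not_isVertexMG_of_thread hG hg hvc (j := i + 1) (by omega) (by omega) ht hfree hlen
      (fun s hs => ?_) hS
    have := F.val_le_kOf hs
    unfold cycDist
    omega
  · refine F.not_isVertexMG_of_thread hG hg hvc (j := if i = 0 then r + r - 1 else i - 1)
      (by omega) (by split_ifs <;> omega) ht hfree hlen (fun s hs => ?_) hS
    have := F.val_le_kOf hs
    unfold cycDist
    split_ifs <;> omega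

include F in
lemma not_configC (hG : G.Connected) (hg : 3 ≤ g) (hvc : IsCycleLabelling G g vc)
    (hcan : Canonical G g vc S) (hS : IsVertexMG G S) : ¬ ConfigC G g vc S := by
  rintro ⟨h2, heven, hk, i, hi, t, ht, hfree, hlen⟩
  have h := ((F.aS_eq_two_iff hg hcan).1 h2).2
  rcases hk.eq_or_lt with hk | hk
  · exact F.not_configA hG hg hvc hcan (Or.inl hS) ⟨h2, heven, hk⟩
  obtain ⟨r, rfl⟩ := heven
  set k := kOf G (r + r) vc S
  refine F.not_isVertexMG_of_thread hG hg hvc (j := r + k - i) (p := r - k - 1) (by omega)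
    (by omega) ht hfree (by omega) (fun s hs => ?_) hS
  have := h s hs
  unfold cycDist
  omega

include F in
lemma not_configD (hG : G.Connected) (hg : 3 ≤ g) (hodd : Odd g) (hvc : IsCycleLabelling G g vc)
    (hS : IsEdgeMG G S) : ¬ ConfigD G g vc S := by
  have : NeZero g := ⟨by omega⟩
  rintro ⟨hk, i, hi, t, ht, hfree⟩
  have hlen := List.length_pos_of_ne_nil ht.1
  obtain ⟨r, rfl⟩ := hodd
  rcases hi with hi | hi
  · refine F.not_isEdgeMG_of_thread hG hg hvc (j := i) (j' := i + 1) (by omega) (by omega)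
      (by omega) (Or.inl rfl) ht hfree hlen (fun s hs => ?_) hS
    have := F.val_le_kOf hs
    unfold cycDist
    omega
  · refine F.not_isEdgeMG_of_thread hG hg hvc (j := if i = 0 then 2 * r else i - 1) (j' := i)
      (by omega) (by split_ifs <;> omega) (by omega) (by split_ifs <;> omega) ht hfree hlen
      (fun s hs => ?_) hS
    have := F.val_le_kOf hs
    unfold cycDist
    split_ifs <;> omega

include F in
lemma not_configE (hG : G.Connected) (hg : 3 ≤ g) (hodd : Odd g) (hvc : IsCycleLabelling G g vc)
    (hcan : Canonical G g vc S) (hS : IsEdgeMG G S) : ¬ ConfigE G g vc S := by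
  rintro ⟨h2, i, hi, ⟨t, ht, hfree, hlen⟩, -⟩
  have h := ((F.aS_eq_two_iff hg hcan).1 h2).2
  have hk := F.kOf_le_half hg hcan h2
  obtain ⟨r, rfl⟩ := hodd
  generalize kOf G (2 * r + 1) vc S = k at *
  have key : ∀ a, a = 0 ∨ a = k → cycDist (2 * r + 1) a i + (r - k) =
      min (cycDist (2 * r + 1) a (r + k - i))
        (cycDist (2 * r + 1) a (if r + k - i = 2 * r then 0 else r + k - i + 1)) := by
    rintro a (rfl | rfl)
    · have e1 : cycDist (2 * r + 1) 0 i = i := by unfold cycDist; omega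
      have e2 : cycDist (2 * r + 1) 0 (r + k - i) =
          min (r + k - i) (r + 1 + i - k) := by unfold cycDist; omega
      split_ifs with h0
      · unfold cycDist at *; omega
      · have e3 : cycDist (2 * r + 1) 0 (r + k - i + 1) = r + i - k := by unfold cycDist; omega
        omega
    · have e1 : cycDist (2 * r + 1) a i = a - i := by unfold cycDist; omega
      have e2 : cycDist (2 * r + 1) a (r + a - i) = r - i := by unfold cycDist; omega
      split_ifs with h0
      · unfold cycDist at *; omega
      · have e3 : cycDist (2 * r + 1) a (r + a - i + 1) = min (r - i + 1) (r + i) := by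
          unfold cycDist; omega
        omega
  refine F.not_isEdgeMG_of_thread hG hg hvc (j := r + k - i) (p := r - k)
    (j' := if r + k - i = 2 * r then 0 else r + k - i + 1) (by omega)
    (by omega) (by split_ifs <;> omega) (by split_ifs <;> omega) ht hfree (by omega)
    (fun s hs => key _ (h s hs)) hS

end CycleForest

end Necessity

section CyclicArithmetic

lemma cycDist_of_le {g a b : ℕ} (h : a ≤ b) : cycDist g a b = min (b - a) (g - (b - a)) := by
  rw [cycDist, Nat.sub_eq_zero_of_le h, zero_add]

lemma cycDist_of_ge {g a b : ℕ} (h : b ≤ a) : cycDist g a b = min (a - b) (g - (a - b)) := by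
  rw [cycDist, Nat.sub_eq_zero_of_le h, add_zero]

/-- The index of `a` after rotating a cycle of length `g` so that `i` becomes `0`. -/
def cycRot (g i a : ℕ) : ℕ := if i ≤ a then a - i else a + g - i

lemma cycRot_spec {g i a : ℕ} (hi : i < g) (ha : a < g) : cycRot g i a < g ∧
    (cycRot g i a + i = a ∨ cycRot g i a + i = a + g) := by
  unfold cycRot
  split_ifs <;> omega

lemma cycRot_self (g i : ℕ) : cycRot g i i = 0 := by simp [cycRot]

lemma cycRot_succ {g i j : ℕ} (hi : i < g) (hj : j < g) :
    cycRot g i (if j + 1 = g then 0 else j + 1) =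
      if cycRot g i j + 1 = g then 0 else cycRot g i j + 1 := by
  unfold cycRot
  split_ifs <;> omega

lemma cycDist_cycRot {g i a b : ℕ} (hi : i < g) (ha : a < g) (hb : b < g) :
    cycDist g (cycRot g i a) (cycRot g i b) = cycDist g a b := by
  have := cycRot_spec hi ha
  have := cycRot_spec hi hb
  rcases le_total a b with h | h
  · rw [cycDist_of_le h]
    unfold cycDist
    omega
  · rw [cycDist_of_ge h]
    unfold cycDist
    omega

lemma cycDist_cycRot_zero {g i a : ℕ} (hi : i < g) (ha : a < g) :
    cycDist g (cycRot g i a) 0 = cycDist g a i := by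
  rw [← cycRot_self g i, cycDist_cycRot hi ha hi]

lemma cycDist_zero_right {g : ℕ} (a : ℕ) : cycDist g a 0 = min a (g - a) := by
  unfold cycDist
  omega

/-- `A ⊆ [0, k]` contains `0` and `k`, and no arc shorter than `k` of a cycle of length `g`
covers `A`. -/
structure IsCycSpan (g k : ℕ) (A : Set ℕ) : Prop where
  zero_mem : 0 ∈ A
  mem : k ∈ A
  le : ∀ a ∈ A, a ≤ k
  pos : 0 < k
  lt : k < g
  le_of_arc : ∀ c < g, ∀ K, (∀ a ∈ A, c ≤ a ∧ a ≤ c + K ∨ a + g ≤ c + K) → k ≤ K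

namespace IsCycSpan

variable {g k : ℕ} {A : Set ℕ} (h : IsCycSpan g k A)

include h

lemma of_arc_right {i L : ℕ} (hi : i < g) (hL : 2 * L + 1 ≤ g) (hA : ∀ a ∈ A, cycRot g i a ≤ L) :
    k ≤ L ∧ (i = 0 ∨ g + k ≤ i + L) := by
  have hk : k ≤ L := h.le_of_arc i hi L fun a ha => by
    have := hA a ha
    have := cycRot_spec hi ((h.le a ha).trans_lt h.lt)
    omega
  have := h.lt
  have h1 := hA 0 h.zero_mem
  have h2 := hA k h.mem
  have := cycRot_spec hi (h.pos.trans h.lt)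
  have := cycRot_spec hi h.lt
  omega

lemma of_arc_left {i L : ℕ} (hi : i < g) (hL : 2 * L + 1 ≤ g)
    (hA : ∀ a ∈ A, cycRot g i a = 0 ∨ g ≤ cycRot g i a + L) : k ≤ L ∧ k ≤ i ∧ i ≤ L := by
  have hk : k ≤ L := h.le_of_arc (if L ≤ i then i - L else i + g - L) (by split_ifs <;> omega) L
    fun a ha => by
      have := hA a ha
      have hag := (h.le a ha).trans_lt h.lt
      have := cycRot_spec hi hag
      split_ifs <;> omega
  have := h.lt
  have h1 := hA 0 h.zero_mem
  have h2 := hA k h.mem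
  have := cycRot_spec hi (h.pos.trans h.lt)
  have := cycRot_spec hi h.lt
  omega

end IsCycSpan

lemma cycDist_level {g α δ p q : ℕ} (hα : α < g) (hδ : δ < g) (h0 : 0 < δ)
    (hpq : q ≤ p)
    (h : min α (g - α) + p = cycDist g α δ + q) : p ≤ min δ (g - δ) + q ∧
      (p < min δ (g - δ) + q → 2 * α + p = δ + q ∨ 2 * α + q = g + δ + p) ∧
      (p = min δ (g - δ) + q → (2 * δ ≤ g ∧ (α = 0 ∨ g + 2 * δ ≤ 2 * α)) ∨
        (g ≤ 2 * δ ∧ 2 * α + g ≤ 2 * δ)) := by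
  rcases le_total α δ with hle | hle
  · rw [cycDist_of_le hle] at h
    omega
  · rw [cycDist_of_ge hle] at h
    omega

lemma cycDist_edge_level {g α δ p : ℕ} (hα : α < g) (hδ : δ < g)
    (h : min α (g - α) + p = min (cycDist g α δ) (cycDist g α (if δ + 1 = g then 0 else δ + 1))) :
    p ≤ min δ (g - 1 - δ) ∧
      (p < min δ (g - 1 - δ) → 2 * α + p = δ ∨ 2 * α = g + δ + 1 + p) ∧
      (p = min δ (g - 1 - δ) → (2 * δ < g ∧ (α = 0 ∨ g + 2 * δ + 1 ≤ 2 * α)) ∨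
        (g ≤ 2 * δ + 1 ∧ 2 * α + g ≤ 2 * δ + 1)) := by
  rcases le_or_gt α δ with hle | hle
  · rw [cycDist_of_le hle] at h
    split_ifs at h with hδ'
    · rw [cycDist_zero_right] at h
      omega
    · rw [cycDist_of_le (by omega)] at h
      omega
  · rw [cycDist_of_ge hle.le, if_neg (by omega), cycDist_of_ge hle] at h
    omega

lemma cycDist_edge_edge {g α δ : ℕ} (hα : α < g) (hδ : δ < g) (h0 : 0 < δ) (hg : 3 ≤ g)
    (h : min (cycDist g α 0) (cycDist g α 1) =
      min (cycDist g α δ) (cycDist g α (if δ + 1 = g then 0 else δ + 1))) :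
    2 * α = δ + 1 ∨ 2 * α = g + δ + 1 ∨ (α = 0 ∧ δ + 1 = g) := by
  rw [cycDist_zero_right] at h
  rcases Nat.eq_zero_or_pos α with rfl | hα0
  · rw [cycDist_of_le (by omega), cycDist_of_le (by omega)] at h
    split_ifs at h with hδ'
    · omega
    · rw [cycDist_of_le (by omega)] at h
      omega
  rw [cycDist_of_ge (a := α) (b := 1) hα0] at h
  rcases le_or_gt α δ with hle | hle
  · rw [cycDist_of_le hle] at h
    split_ifs at h with hδ'
    · rw [cycDist_zero_right] at h
      omega
    · rw [cycDist_of_le (by omega)] at h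
      omega
  · rw [cycDist_of_ge hle.le, if_neg (by omega), cycDist_of_ge hle] at h
    omega

namespace IsCycSpan

variable {g k : ℕ} {A : Set ℕ} (h : IsCycSpan g k A)

include h

lemma cycRot_lt {i a : ℕ} (hi : i < g) (ha : a ∈ A) :
    cycRot g i a < g ∧ (cycRot g i a + i = a ∨ cycRot g i a + i = a + g) :=
  cycRot_spec hi ((h.le a ha).trans_lt h.lt)

/-- Two branches at `i ≠ j`: either all active vertices are on one side, or they are close to
being antipodal. -/
lemma of_tree_tree {i j p q : ℕ} (hi : i < g) (hj : j < g) (hij : i ≠ j) (hpq : q ≤ p)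
    (hA : ∀ a ∈ A, cycDist g a i + p = cycDist g a j + q) :
    (0 < p ∧ 2 * k + 2 ≤ g ∧ (k ≤ i ∧ 2 * i + 2 ≤ g ∨ i = 0 ∨ g + 2 * k + 2 ≤ 2 * i)) ∨
      (Even g ∧ (∀ a ∈ A, a = 0 ∨ a = k) ∧ (2 * k = g ∨
        2 * k < g ∧ i ≤ k ∧ 2 * j + 2 * i = g + 2 * k ∧ g ≤ 2 * p + 2 * k)) := by
  have hδ := cycRot_spec hi hj
  set δ := cycRot g i j
  have key : ∀ a ∈ A, _ := fun a ha => cycDist_level (h.cycRot_lt hi ha).1 hδ.1 (by omega) hpq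
    (by
      have hag := (h.le a ha).trans_lt h.lt
      rw [← cycDist_zero_right, cycDist_cycRot_zero hi hag, cycDist_cycRot hi hag hj]
      exact hA a ha)
  rcases (key 0 h.zero_mem).1.eq_or_lt with hp | hp
  · left
    rcases le_or_gt (2 * δ) g with hd | hd
    · obtain ⟨h1, h2⟩ := h.of_arc_left (L := g / 2 - δ) hi (by omega) (fun a ha => by
        have := (key a ha).2.2 (by have := (key a ha).1; omega)
        have := h.cycRot_lt hi ha
        omega)
      have := h.pos
      omega
    · obtain ⟨h1, h2⟩ := h.of_arc_right (L := δ - (g + 1) / 2) hi (by omega) (fun a ha => by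
        have := (key a ha).2.2 (by have := (key a ha).1; omega)
        omega)
      have := h.pos
      omega
  · right
    have hlvl : ∀ a ∈ A, _ := fun a ha => (key a ha).2.1 hp
    have h0 := hlvl 0 h.zero_mem
    have hk := hlvl k h.mem
    have r0 := h.cycRot_lt hi h.zero_mem
    have rk := h.cycRot_lt hi h.mem
    have hpos := h.pos
    have hlt := h.lt
    have hpair : ∀ a ∈ A, a = 0 ∨ a = k := fun a ha => by
      have := hlvl a ha
      have := h.cycRot_lt hi ha
      have := h.le a ha
      omega
    have hkg : k ≤ g - k := h.le_of_arc k h.lt _ fun a ha => by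
      have := hpair a ha
      omega
    exact ⟨by rw [Nat.even_iff]; omega, hpair, by omega⟩

lemma of_tree_edge {i j p : ℕ} (heven : Even g) (hi : i < g) (hj : j < g)
    (hA : ∀ a ∈ A, cycDist g a i + p =
      min (cycDist g a j) (cycDist g a (if j + 1 = g then 0 else j + 1))) :
    2 * k + 2 ≤ g ∧ (k ≤ i ∧ 2 * i + 2 ≤ g ∨ i = 0 ∨ g + 2 * k + 2 ≤ 2 * i) := by
  obtain ⟨m, rfl⟩ := heven.exists_two_nsmul
  rw [smul_eq_mul] at *
  have hδ := (cycRot_spec hi hj).1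
  have hsucc := cycRot_succ (g := 2 * m) hi hj
  set δ := cycRot (2 * m) i j
  have key : ∀ a ∈ A, _ := fun a ha => cycDist_edge_level (p := p) (h.cycRot_lt hi ha).1 hδ
    (by
      have hag := (h.le a ha).trans_lt h.lt
      rw [← hsucc, ← cycDist_zero_right, cycDist_cycRot_zero hi hag, cycDist_cycRot hi hag hj,
        cycDist_cycRot hi hag (by split_ifs <;> omega)]
      exact hA a ha)
  have hpos := h.pos
  rcases (key 0 h.zero_mem).1.eq_or_lt with hp | hp
  · rcases le_or_gt m δ with hd | hd
    · obtain ⟨h1, h2⟩ := h.of_arc_right (L := δ - m) hi (by omega) (fun a ha => by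
        have := (key a ha).2.2 hp
        omega)
      omega
    · obtain ⟨h1, h2⟩ := h.of_arc_left (L := m - 1 - δ) hi (by omega) (fun a ha => by
        have := (key a ha).2.2 hp
        have := h.cycRot_lt hi ha
        omega)
      omega
  · have h0 := (key 0 h.zero_mem).2.1 hp
    have hk := (key k h.mem).2.1 hp
    have := h.cycRot_lt hi h.zero_mem
    have := h.cycRot_lt hi h.mem
    have := h.lt
    omega

lemma of_edge_edge {i j : ℕ} (hi : i < g) (hj : j < g) (hij : i ≠ j) (hg : 3 ≤ g)
    (hA : ∀ a ∈ A, min (cycDist g a i) (cycDist g a (if i + 1 = g then 0 else i + 1)) =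
      min (cycDist g a j) (cycDist g a (if j + 1 = g then 0 else j + 1))) :
    (∀ a ∈ A, a = 0 ∨ a = k) ∧ 2 * k = g := by
  have hδ := cycRot_spec hi hj
  have hsucc := cycRot_succ (g := g) hi hj
  have hsucc' := cycRot_succ (g := g) hi hi
  rw [cycRot_self, if_neg (by omega : ¬ 0 + 1 = g), zero_add] at hsucc'
  set δ := cycRot g i j
  have key : ∀ a ∈ A, _ := fun a ha => cycDist_edge_edge (h.cycRot_lt hi ha).1 hδ.1 (by omega) hg
    (by
      have hag := (h.le a ha).trans_lt h.lt
      have := hA a ha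
      rwa [← cycDist_cycRot_zero hi hag, ← cycDist_cycRot hi hag hj,
        ← cycDist_cycRot (b := if i + 1 = g then 0 else i + 1) hi hag (by split_ifs <;> omega),
        ← cycDist_cycRot (b := if j + 1 = g then 0 else j + 1) hi hag (by split_ifs <;> omega),
        hsucc, hsucc'] at this)
  have h0 := key 0 h.zero_mem
  have hk := key k h.mem
  have r0 := h.cycRot_lt hi h.zero_mem
  have rk := h.cycRot_lt hi h.mem
  have hpos := h.pos
  have hlt := h.lt
  have hpair : ∀ a ∈ A, a = 0 ∨ a = k := fun a ha => by
    have := key a ha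
    have := h.cycRot_lt hi ha
    have := h.le a ha
    omega
  have hkg : k ≤ g - k := h.le_of_arc k h.lt _ fun a ha => by
    have := hpair a ha
    omega
  exact ⟨hpair, by omega⟩

end IsCycSpan

end CyclicArithmetic

section Sufficiency

namespace CycleForest

variable {V : Type*} {G : SimpleGraph V} {S : Set V} {g : ℕ} {vc : ZMod g → V}
  (F : CycleForest G g vc)

lemma isCycSpan [NeZero g] (hcan : Canonical G g vc S) (hS : Biactive G g vc S) :
    IsCycSpan g (kOf G g vc S) {a | ∃ s ∈ S, (F.root s).val = a} where
  zero_mem := F.exists_val_eq_zero hcan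
  mem := F.exists_val_eq_kOf (NeZero.pos g) hcan
  le := by
    rintro _ ⟨s, hs, rfl⟩
    exact F.val_le_kOf hs
  pos := by
    obtain ⟨s, hs, s', hs', hne⟩ := F.biactive_iff.1 hS
    have := F.val_le_kOf hs
    have := F.val_le_kOf hs'
    by_contra! h0
    exact hne (ZMod.val_injective g (by omega))
  lt := by
    obtain ⟨s, -, h⟩ := F.exists_val_eq_kOf (NeZero.pos g) hcan
    exact h ▸ ZMod.val_lt _
  le_of_arc c hc K h := F.kOf_le_of_arc hcan hc fun s hs => h _ ⟨s, hs, rfl⟩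

/-- `E` measures distances to an object at distance `P` from the cycle which lies in the branch
of `x`. -/
structure IsBranchDist (x : V) (P : ℕ) (E : V → ℕ) : Prop where
  eq : ∀ s, ¬ F.Desc (F.top x) s →
    E s = F.height s + cycDist g (F.root s).val (F.root x).val + P
  lt : ∀ s, F.Desc (F.top x) s → E s < F.height s + P

variable {F}

lemma IsBranchDist.le {x : V} {P : ℕ} {E : V → ℕ} (h : F.IsBranchDist x P E) (s : V) :
    E s ≤ F.height s + cycDist g (F.root s).val (F.root x).val + P := by
  by_cases hd : F.Desc (F.top x) s
  · have := h.lt s hd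
    omega
  · exact (h.eq s hd).le

lemma IsBranchDist.eq_of_root_ne {x s : V} {P : ℕ} {E : V → ℕ} (h : F.IsBranchDist x P E)
    (hs : F.root s ≠ F.root x) :
    E s = F.height s + cycDist g (F.root s).val (F.root x).val + P :=
  h.eq s fun hd => hs (hd.root_eq.trans (F.root_top x))

lemma isBranchDist_dist (hG : G.Connected) (hg : 3 ≤ g) (hvc : IsCycleLabelling G g vc) {x : V}
    (hx : 0 < F.height x) : F.IsBranchDist x (F.height x) (G.dist · x) where
  eq s hs := by rw [F.dist_of_not_desc_top hG hx hs, F.dist_vc hG hg hvc]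
  lt s hs := by
    have := F.dist_add_two_le hG (by rw [F.height_top hx]; omega) hs (F.desc_top x)
    omega

lemma edgeDist_par_add_one (hG : G.Connected) {x s : V} (hx : 0 < F.height x)
    (hs : ¬ F.Desc x s) : edgeDist G s s(x, F.par x) + 1 = G.dist s x := by
  have := F.dist_of_not_desc hG hx (F.desc_refl x) hs
  have := F.height_par x hx
  rw [edgeDist_mk]
  omega

lemma isBranchDist_edgeDist (hG : G.Connected) (hg : 3 ≤ g) (hvc : IsCycleLabelling G g vc)
    {x : V} (hx : 0 < F.height x) :
    F.IsBranchDist x (F.height x - 1) (edgeDist G · s(x, F.par x)) where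
  eq s hs := by
    have := F.edgeDist_par_add_one hG hx (s := s) (fun ⟨m, hm⟩ => hs
      ⟨F.height x - 1 + m, by rw [Function.iterate_add_apply, hm]; rfl⟩)
    have := (isBranchDist_dist hG hg hvc hx).eq s hs
    omega
  lt s hs := by
    have := F.dist_add_two_le hG (by rw [F.height_top hx]; omega) hs (F.desc_top x)
    rw [edgeDist_mk]
    omega

/-- If `E` agrees on `S` with distances to an object seen only through the cycle from the tree of
`x`, then `S` misses the branch of `x`. -/
lemma IsBranchDist.not_desc {x : V} {P : ℕ} {E D : V → ℕ} {m : ZMod g → ℕ}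
    (h : F.IsBranchDist x P E) (hle : ∀ s, D s ≤ F.height s + m (F.root s))
    (heq : ∀ s, F.root s = F.root x → D s = F.height s + m (F.root x))
    (hm : ∀ a, m a ≤ cycDist g a.val (F.root x).val + m (F.root x))
    (hED : ∀ s ∈ S, E s = D s) (hne : ∃ s ∈ S, F.root s ≠ F.root x) :
    ∀ s ∈ S, ¬ F.Desc (F.top x) s := by
  intro s hs hd
  obtain ⟨s', hs', hne⟩ := hne
  have := h.lt s hd
  have := heq s (hd.root_eq.trans (F.root_top x))
  have := h.eq_of_root_ne hne
  have := hle s'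
  have := hm (F.root s')
  have := hED s hs
  have := hED s' hs'
  omega

lemma cycDist_triangle (F : CycleForest G g vc) (hG : G.Connected) (hg : 3 ≤ g)
    (hvc : IsCycleLabelling G g vc) (a b c : ZMod g) :
    cycDist g a.val c.val ≤ cycDist g a.val b.val + cycDist g b.val c.val := by
  simp only [← F.dist_vc_vc hG hg hvc]
  exact hG.dist_triangle

lemma exists_root_ne [NeZero g] (hS : Biactive G g vc S) (i : ZMod g) :
    ∃ s ∈ S, F.root s ≠ i := by
  obtain ⟨s, hs, s', hs', hne⟩ := F.biactive_iff.1 hS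
  by_cases h : F.root s = i
  · exact ⟨s', hs', h ▸ hne.symm⟩
  · exact ⟨s, hs, h⟩

lemma IsBranchDist.not_desc_of_root_ne (hG : G.Connected) (hg : 3 ≤ g)
    (hvc : IsCycleLabelling G g vc) (hS : Biactive G g vc S) {x y : V} {P Q : ℕ} {E D : V → ℕ}
    (hx : F.IsBranchDist x P E) (hxy : F.root x ≠ F.root y)
    (hle : ∀ s, D s ≤ F.height s + cycDist g (F.root s).val (F.root y).val + Q)
    (heq : ∀ s, F.root s ≠ F.root y →
      D s = F.height s + cycDist g (F.root s).val (F.root y).val + Q)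
    (hED : ∀ s ∈ S, E s = D s) : ∀ s ∈ S, ¬ F.Desc (F.top x) s := by
  have : NeZero g := ⟨by omega⟩
  refine hx.not_desc (m := fun a => cycDist g a.val (F.root y).val + Q) (fun s => ?_)
    (fun s hs => ?_) (fun a => ?_) hED (exists_root_ne hS _)
  · rw [← add_assoc]
    exact hle s
  · rw [heq s (hs ▸ hxy), hs, add_assoc]
  · have := F.cycDist_triangle hG hg hvc a (F.root x) (F.root y)
    omega

lemma IsBranchDist.not_desc_branch (hG : G.Connected) (hg : 3 ≤ g)
    (hvc : IsCycleLabelling G g vc) (hS : Biactive G g vc S) {x y : V} {P Q : ℕ} {E D : V → ℕ}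
    (hx : F.IsBranchDist x P E) (hy : F.IsBranchDist y Q D) (hxy : F.root x ≠ F.root y)
    (hED : ∀ s ∈ S, E s = D s) : ∀ s ∈ S, ¬ F.Desc (F.top x) s :=
  hx.not_desc_of_root_ne hG hg hvc hS hxy hy.le (fun _ => hy.eq_of_root_ne) hED

lemma IsBranchDist.cycDist_eq (hG : G.Connected) (hg : 3 ≤ g)
    (hvc : IsCycleLabelling G g vc) (hS : Biactive G g vc S) {x y : V} {P Q : ℕ} {E D : V → ℕ}
    (hx : F.IsBranchDist x P E) (hy : F.IsBranchDist y Q D) (hxy : F.root x ≠ F.root y)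
    (hED : ∀ s ∈ S, E s = D s) {s : V} (hs : s ∈ S) :
    cycDist g (F.root s).val (F.root x).val + P = cycDist g (F.root s).val (F.root y).val + Q := by
  have h1 := hx.eq s (hx.not_desc_branch hG hg hvc hS hy hxy hED s hs)
  have h2 := hy.eq s (hy.not_desc_branch hG hg hvc hS hx hxy.symm (fun s hs => (hED s hs).symm)
    s hs)
  have := hED s hs
  omega

lemma IsBranchDist.offset_eq_of_root_eq [NeZero g] (hS : Biactive G g vc S) {x y : V} {P Q : ℕ}
    {E D : V → ℕ} (hx : F.IsBranchDist x P E) (hy : F.IsBranchDist y Q D)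
    (hxy : F.root x = F.root y) (hED : ∀ s ∈ S, E s = D s) : P = Q := by
  obtain ⟨s, hs, hne⟩ := F.exists_root_ne hS (F.root x)
  have := hx.eq_of_root_ne hne
  have := hy.eq_of_root_ne (hxy ▸ hne)
  have := hED s hs
  rw [hxy] at *
  omega

lemma dist_eq_of_forall_eq (hG : G.Connected) (hg : 3 ≤ g) (hvc : IsCycleLabelling G g vc)
    (hS : Biactive G g vc S) {x y : V} (hxy : F.root x ≠ F.root y)
    (h : ∀ s ∈ S, G.dist s x = G.dist s y) {s : V} (hs : s ∈ S) :
    G.dist s x = F.height s + cycDist g (F.root s).val (F.root x).val + F.height x := by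
  rcases Nat.eq_zero_or_pos (F.height x) with h0 | h0
  · conv_lhs => rw [F.eq_vc x h0]
    rw [F.dist_vc hG hg hvc, h0, add_zero]
  · exact (isBranchDist_dist hG hg hvc h0).eq s ((isBranchDist_dist hG hg hvc h0).not_desc_of_root_ne
      hG hg hvc hS hxy (fun s => F.dist_le hG hg hvc s y) (fun s => F.dist_eq hG hg hvc) h s hs)

lemma mem_edgeSet_cases (F : CycleForest G g vc) {e : Sym2 V} (he : e ∈ G.edgeSet) :
    (∃ x, 0 < F.height x ∧ e = s(x, F.par x)) ∨ ∃ j, e = s(vc j, vc (j + 1)) := by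
  induction e with | _ x y => ?_
  rcases F.adj_cases x y he with ⟨hx, rfl⟩ | ⟨hy, rfl⟩ | ⟨hx, hy, h | h⟩
  · exact Or.inl ⟨x, hx, rfl⟩
  · exact Or.inl ⟨y, hy, Sym2.eq_swap⟩
  · exact Or.inr ⟨F.root x, by rw [F.eq_vc x hx, F.eq_vc y hy, h, F.root_vc]⟩
  · exact Or.inr ⟨F.root y, by rw [F.eq_vc x hx, F.eq_vc y hy, h, F.root_vc, Sym2.eq_swap]⟩

lemma val_add_one_eq_ite (hg : 3 ≤ g) (j : ZMod g) :
    (j + 1).val = if j.val + 1 = g then 0 else j.val + 1 := by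
  have : NeZero g := ⟨by omega⟩
  have := ZMod.val_add_one_cases hg j
  have := ZMod.val_lt (j + 1)
  split_ifs <;> omega

lemma edgeDist_cycle (F : CycleForest G g vc) (hG : G.Connected) (hg : 3 ≤ g)
    (hvc : IsCycleLabelling G g vc) (s : V) (j : ZMod g) :
    edgeDist G s s(vc j, vc (j + 1)) = F.height s + min (cycDist g (F.root s).val j.val)
      (cycDist g (F.root s).val (if j.val + 1 = g then 0 else j.val + 1)) := by
  rw [edgeDist_mk, F.dist_vc hG hg hvc, F.dist_vc hG hg hvc, val_add_one_eq_ite hg,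
    Nat.add_min_add_left]

variable [Fintype V] [DecidableRel G.Adj]

lemma configD_of (heven : Even g) (hg : 3 ≤ g) {i : ZMod g} {t : List V}
    (hk : 2 * kOf G g vc S + 2 ≤ g)
    (hi : kOf G g vc S ≤ i.val ∧ 2 * i.val + 2 ≤ g ∨ i.val = 0 ∨
      g + 2 * kOf G g vc S + 2 ≤ 2 * i.val)
    (ht : IsThreadAt G (vc i) t) (hfree : SFree S t) : ConfigD G g vc S := by
  have : NeZero g := ⟨by omega⟩
  have := ZMod.val_lt i
  obtain ⟨r, rfl⟩ := heven
  exact ⟨by omega, i.val, by omega, t, by rwa [ZMod.natCast_zmod_val], hfree⟩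

variable [DecidableEq V]

/-- For odd `g`, configuration `B` is the only obstruction to being a vertex metric generator. -/
lemma isVertexMG_of_not_configB (F : CycleForest G g vc) (hG : G.Connected) (hg : 3 ≤ g)
    (hodd : Odd g) (hvc : IsCycleLabelling G g vc) (hcan : Canonical G g vc S)
    (hBR : BranchResolving G S) (hS : Biactive G g vc S) (hB : ¬ ConfigB G g vc S) :
    IsVertexMG G S := by
  have : NeZero g := ⟨by omega⟩
  intro x y hne
  by_contra! h
  by_cases hroot : F.root x = F.root y
  · by_cases hheight : F.height x = F.height y
    · obtain ⟨s, hs, hd⟩ := F.exists_of_height_eq hG hvc hBR hne hroot hheight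
      have := h s hs
      omega
    · obtain ⟨s, hs, hsx⟩ := F.exists_root_ne hS (F.root x)
      have := h s hs
      rw [F.dist_eq hG hg hvc hsx, F.dist_eq hG hg hvc (hroot ▸ hsx), hroot] at this
      omega
  wlog hle : F.height y ≤ F.height x generalizing x y
  · exact this y x hne.symm (fun s hs => (h s hs).symm) (Ne.symm hroot) (by omega)
  have key := (F.isCycSpan hcan hS).of_tree_tree (ZMod.val_lt (F.root x))
    (ZMod.val_lt (F.root y)) (fun he => hroot (ZMod.val_injective g he)) hle (by
      rintro _ ⟨s, hs, rfl⟩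
      have h1 := dist_eq_of_forall_eq (F := F) hG hg hvc hS hroot h hs
      have h2 := dist_eq_of_forall_eq (F := F) hG hg hvc hS (Ne.symm hroot)
        (fun s hs => (h s hs).symm) hs
      have := h s hs
      omega)
  rcases key with ⟨h0, hk, hi⟩ | ⟨he, -⟩
  · obtain ⟨t, ht, hfree, -⟩ := F.exists_thread_of_height_pos hg hvc hBR h0
      ((isBranchDist_dist hG hg hvc h0).not_desc_of_root_ne
      hG hg hvc hS hroot (fun s => F.dist_le hG hg hvc s y) (fun s => F.dist_eq hG hg hvc) h)
    have := ZMod.val_lt (F.root x)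
    obtain ⟨r, rfl⟩ := hodd
    exact hB ⟨by omega, (F.root x).val, by omega, t, by rwa [ZMod.natCast_zmod_val], hfree⟩
  · exact Nat.not_even_iff_odd.2 hodd he

lemma exists_edgeDist_par_ne_par (hG : G.Connected) (hg : 3 ≤ g) (heven : Even g)
    (hvc : IsCycleLabelling G g vc) (hcan : Canonical G g vc S)
    (hBR : BranchResolving G S) (hS : Biactive G g vc S) (hA : ¬ ConfigA G g vc S)
    (hD : ¬ ConfigD G g vc S) (hE : ¬ ConfigE G g vc S) {x y : V} (hx : 0 < F.height x)
    (hy : 0 < F.height y) (hxy : F.root x ≠ F.root y) :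
    ∃ s ∈ S, edgeDist G s s(x, F.par x) ≠ edgeDist G s s(y, F.par y) := by
  have : NeZero g := ⟨by omega⟩
  by_contra! h
  wlog hle : F.height y ≤ F.height x generalizing x y
  · exact this hy hx hxy.symm (fun s hs => (h s hs).symm) (by omega)
  have hbx := isBranchDist_edgeDist (F := F) hG hg hvc hx
  have hby := isBranchDist_edgeDist (F := F) hG hg hvc hy
  obtain ⟨t, ht, hfree, hlen⟩ := F.exists_thread_of_height_pos hg hvc hBR hx
    (hbx.not_desc_branch hG hg hvc hS hby hxy h)
  obtain ⟨t', ht', hfree', -⟩ := F.exists_thread_of_height_pos hg hvc hBR hy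
    (hby.not_desc_branch hG hg hvc hS hbx hxy.symm fun s hs => (h s hs).symm)
  have key := (F.isCycSpan hcan hS).of_tree_tree (ZMod.val_lt (F.root x))
    (ZMod.val_lt (F.root y)) (fun he => hxy (ZMod.val_injective g he))
    (by omega : F.height y - 1 ≤ F.height x - 1) (by
      rintro _ ⟨s, hs, rfl⟩
      exact hbx.cycDist_eq hG hg hvc hS hby hxy h hs)
  rcases key with ⟨-, hk, hi⟩ | ⟨-, hpair, hk⟩
  · exact hD (configD_of heven hg hk hi ht hfree)
  have h2 : aS G g vc S = 2 := (F.aS_eq_two_iff hg hcan).2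
    ⟨(F.isCycSpan hcan hS).pos, fun s hs => hpair _ ⟨s, hs, rfl⟩⟩
  rcases hk with hk | ⟨hk, hik, hj, hp⟩
  · exact hA ⟨h2, heven, by omega⟩
  · refine hE ⟨h2, (F.root x).val, hik, ⟨t, by rwa [ZMod.natCast_zmod_val], hfree, by omega⟩,
      fun _ => ⟨t', ?_, hfree'⟩⟩
    rwa [show g / 2 + kOf G g vc S - (F.root x).val = (F.root y).val by omega,
      ZMod.natCast_zmod_val]

lemma exists_edgeDist_par_ne_cycle (hG : G.Connected) (hg : 3 ≤ g) (heven : Even g)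
    (hvc : IsCycleLabelling G g vc) (hcan : Canonical G g vc S)
    (hBR : BranchResolving G S) (hS : Biactive G g vc S)
    (hD : ¬ ConfigD G g vc S) {x : V} (hx : 0 < F.height x) (j : ZMod g) :
    ∃ s ∈ S, edgeDist G s s(x, F.par x) ≠ edgeDist G s s(vc j, vc (j + 1)) := by
  have : NeZero g := ⟨by omega⟩
  by_contra! h
  have hbx := isBranchDist_edgeDist (F := F) hG hg hvc hx
  have hn := hbx.not_desc (m := fun a => min (cycDist g a.val j.val) (cycDist g a.val (j + 1).val))
    (D := (edgeDist G · s(vc j, vc (j + 1))))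
    (fun s => by rw [F.edgeDist_cycle hG hg hvc, val_add_one_eq_ite hg])
    (fun s hs => by rw [F.edgeDist_cycle hG hg hvc, val_add_one_eq_ite hg, hs])
    (fun a => by
      have := F.cycDist_triangle hG hg hvc a (F.root x) j
      have := F.cycDist_triangle hG hg hvc a (F.root x) (j + 1)
      omega) h (exists_root_ne hS _)
  obtain ⟨t, ht, hfree, -⟩ := F.exists_thread_of_height_pos hg hvc hBR hx hn
  have key := (F.isCycSpan hcan hS).of_tree_edge heven (ZMod.val_lt (F.root x))
    (ZMod.val_lt j) (p := F.height x - 1) (by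
      rintro _ ⟨s, hs, rfl⟩
      have h1 := hbx.eq s (hn s hs)
      have h2 := F.edgeDist_cycle hG hg hvc s j
      have := h s hs
      omega)
  exact hD (configD_of heven hg key.1 key.2 ht hfree)

/-- For even `g`, configurations `A`, `D` and `E` are the only obstructions to being an edge
metric generator. -/
lemma isEdgeMG_of_not_config (F : CycleForest G g vc) (hG : G.Connected) (hg : 3 ≤ g)
    (heven : Even g) (hvc : IsCycleLabelling G g vc) (hcan : Canonical G g vc S)
    (hBR : BranchResolving G S) (hS : Biactive G g vc S) (hA : ¬ ConfigA G g vc S)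
    (hD : ¬ ConfigD G g vc S) (hE : ¬ ConfigE G g vc S) : IsEdgeMG G S := by
  have : NeZero g := ⟨by omega⟩
  intro e he f hf hef
  rcases F.mem_edgeSet_cases he with ⟨x, hx, rfl⟩ | ⟨i, rfl⟩ <;>
    rcases F.mem_edgeSet_cases hf with ⟨y, hy, rfl⟩ | ⟨j, rfl⟩
  · by_cases hroot : F.root x = F.root y
    · by_contra! h
      have hh := (isBranchDist_edgeDist (F := F) hG hg hvc hx).offset_eq_of_root_eq hS
        (isBranchDist_edgeDist (F := F) hG hg hvc hy) hroot h
      obtain ⟨s, hs, ⟨hd, hn⟩ | ⟨hd, hn⟩⟩ := F.exists_of_height_eq hG hvc hBR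
        (by rintro rfl; exact hef rfl : x ≠ y) hroot (by omega)
      · have := F.edgeDist_par_add_one hG hy hn
        have := h s hs
        rw [edgeDist_mk s x] at this
        omega
      · have := F.edgeDist_par_add_one hG hx hn
        have := h s hs
        rw [edgeDist_mk s y] at this
        omega
    · exact exists_edgeDist_par_ne_par hG hg heven hvc hcan hBR hS hA hD hE hx hy hroot
  · exact exists_edgeDist_par_ne_cycle hG hg heven hvc hcan hBR hS hD hx j
  · obtain ⟨s, hs, h⟩ := exists_edgeDist_par_ne_cycle (F := F) hG hg heven hvc hcan hBR hS hD hy i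
    exact ⟨s, hs, h.symm⟩
  · by_contra! h
    obtain ⟨hpair, hk⟩ := (F.isCycSpan hcan hS).of_edge_edge (ZMod.val_lt i) (ZMod.val_lt j)
      (fun he => hef (by rw [ZMod.val_injective g he])) hg (by
        rintro _ ⟨s, hs, rfl⟩
        have := h s hs
        rw [F.edgeDist_cycle hG hg hvc, F.edgeDist_cycle hG hg hvc] at this
        omega)
    exact hA ⟨(F.aS_eq_two_iff hg hcan).2
      ⟨(F.isCycSpan hcan hS).pos, fun s hs => hpair _ ⟨s, hs, rfl⟩⟩, heven, by omega⟩

end CycleForest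

end Sufficiency

section Comparison

variable {V : Type*} {P Q : Finset V → Prop}

lemma sInf_card_le (hQ : ∃ S, Q S) (h : ∀ S, Q S → P S) :
    sInf {n | ∃ S : Finset V, S.card = n ∧ P S} ≤ sInf {n | ∃ S : Finset V, S.card = n ∧ Q S} := by
  obtain ⟨S₀, hS₀⟩ := hQ
  obtain ⟨S, hS, hQS⟩ := Nat.sInf_mem (s := {n | ∃ S : Finset V, S.card = n ∧ Q S})
    ⟨_, S₀, rfl, hS₀⟩
  exact Nat.sInf_le ⟨S, hS, h S hQS⟩

lemma sInf_card_lt (hQ : ∃ S, Q S) {T : Finset V} (hT : P T) (h : ∀ S, Q S → T.card < S.card) :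
    sInf {n | ∃ S : Finset V, S.card = n ∧ P S} < sInf {n | ∃ S : Finset V, S.card = n ∧ Q S} := by
  obtain ⟨S₀, hS₀⟩ := hQ
  obtain ⟨S, hS, hQS⟩ := Nat.sInf_mem (s := {n | ∃ S : Finset V, S.card = n ∧ Q S})
    ⟨_, S₀, rfl, hS₀⟩
  exact lt_of_le_of_lt (Nat.sInf_le ⟨T, rfl, hT⟩) (hS ▸ h S hQS)

lemma isVertexMG_univ [Fintype V] {G : SimpleGraph V} (hG : G.Connected) :
    IsVertexMG G ↑(Finset.univ : Finset V) := fun u v huv =>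
  ⟨u, by simp, by rw [dist_self]; exact (hG.pos_dist_of_ne huv).ne⟩

lemma isEdgeMG_univ [Fintype V] {G : SimpleGraph V} (hG : G.Connected) :
    IsEdgeMG G ↑(Finset.univ : Finset V) := by
  intro e he f hf hef
  by_contra! h
  refine hef (Sym2.ext fun z => ?_)
  have key : ∀ e : Sym2 V, edgeDist G z e = 0 ↔ z ∈ e := by
    intro e
    induction e with | _ x y => ?_
    rw [edgeDist_mk, Sym2.mem_iff, Nat.min_eq_zero_iff, hG.dist_eq_zero_iff,
      hG.dist_eq_zero_iff]
  rw [← key, ← key, h z (by simp)]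

end Comparison

section Main

variable {V : Type*} [Fintype V] {G : SimpleGraph V} [DecidableRel G.Adj]
  {S : Set V} {g : ℕ} {vc : ZMod g → V}

lemma ContainsABC.containsADE (hodd : Odd g) (h : ContainsABC G g vc S) :
    ContainsADE G g vc S := by
  rcases h with h | ⟨vc', hvc', hr, hcan, hk, i, hi, ht⟩ | ⟨_, _, _, _, -, heven, -⟩
  · exact Or.inl h
  · exact Or.inr (Or.inl ⟨vc', hvc', hr, hcan, by omega, i, by omega, ht⟩)
  · exact absurd heven (Nat.not_even_iff_odd.2 hodd)

lemma ContainsADE.containsABC (hG : IsUnicyclic G) (hg : 3 ≤ g) (heven : Even g)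
    (h : ContainsADE G g vc S) : ContainsABC G g vc S := by
  rcases h with h | ⟨vc', hvc', hr, hcan, hk, i, hi, ht⟩ |
    ⟨vc', hvc', hr, hcan, h2, i, hi, ⟨t, ht, hfree, hlen⟩, -⟩
  · exact Or.inl h
  · obtain ⟨r, rfl⟩ := heven
    exact Or.inr (Or.inl ⟨vc', hvc', hr, hcan, by omega, i, by omega, ht⟩)
  · obtain ⟨F⟩ := CycleForest.exists hg hG hvc'
    exact Or.inr (Or.inr ⟨vc', hvc', hr, hcan, h2, heven, F.kOf_le_half hg hcan h2, i, hi, t, ht,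
      hfree, by omega⟩)

/-- If no smallest biactive branch-resolving set satisfies `N`, any biactive branch-resolving set
satisfying `N` is larger than a smallest one. -/
lemma SmallestBBR.card_lt {T S : Finset V} (hT : SmallestBBR G g vc T) {N : Finset V → Prop}
    (hN : ¬ ∃ S, SmallestBBR G g vc S ∧ N S) (hS : BranchResolving G (S : Set V) ∧ Biactive G g vc S)
    (hNS : N S) : T.card < S.card := by
  refine (hT.2.2 S hS.1 hS.2).lt_of_ne fun he => hN ⟨S, ⟨hS.1, hS.2, fun S' h1 h2 => ?_⟩, hNS⟩
  exact he ▸ hT.2.2 S' h1 h2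

variable [DecidableEq V]

lemma isVertexMG_of_not_containsABC (hG : IsUnicyclic G) (hg : 3 ≤ g) (hodd : Odd g)
    (hvc : IsCycleLabelling G g vc) (hBR : BranchResolving G S) (hS : Biactive G g vc S)
    (h : ¬ ContainsABC G g vc S) : IsVertexMG G S := by
  have : NeZero g := ⟨by omega⟩
  obtain ⟨F⟩ := CycleForest.exists hg hG hvc
  obtain ⟨s, hs, -⟩ := F.biactive_iff.1 hS
  obtain ⟨vc', hvc', hr, hcan⟩ := exists_canonical hvc (F.sActive_iff.2 ⟨s, hs, rfl⟩)
  obtain ⟨F'⟩ := CycleForest.exists hg hG hvc'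
  exact F'.isVertexMG_of_not_configB hG.1 hg hodd hvc' hcan hBR
    (F.biactive_of_range_eq F' hvc hvc' hr hS) fun hB => h (Or.inr (Or.inl ⟨vc', hvc', hr, hcan, hB⟩))

lemma isEdgeMG_of_not_containsADE (hG : IsUnicyclic G) (hg : 3 ≤ g) (heven : Even g)
    (hvc : IsCycleLabelling G g vc) (hBR : BranchResolving G S) (hS : Biactive G g vc S)
    (h : ¬ ContainsADE G g vc S) : IsEdgeMG G S := by
  have : NeZero g := ⟨by omega⟩
  obtain ⟨F⟩ := CycleForest.exists hg hG hvc
  obtain ⟨s, hs, -⟩ := F.biactive_iff.1 hS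
  obtain ⟨vc', hvc', hr, hcan⟩ := exists_canonical hvc (F.sActive_iff.2 ⟨s, hs, rfl⟩)
  obtain ⟨F'⟩ := CycleForest.exists hg hG hvc'
  exact F'.isEdgeMG_of_not_config hG.1 hg heven hvc' hcan hBR
    (F.biactive_of_range_eq F' hvc hvc' hr hS) (fun hA => h (Or.inl ⟨vc', hvc', hr, hcan, hA⟩))
    (fun hD => h (Or.inr (Or.inl ⟨vc', hvc', hr, hcan, hD⟩)))
    fun hE => h (Or.inr (Or.inr ⟨vc', hvc', hr, hcan, hE⟩))

lemma not_containsADE_of_isEdgeMG (hG : IsUnicyclic G) (hg : 3 ≤ g) (hodd : Odd g)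
    (hS : IsEdgeMG G S) : ¬ ContainsADE G g vc S := by
  rintro (⟨vc', hvc', hr, hcan, h⟩ | ⟨vc', hvc', hr, hcan, h⟩ | ⟨vc', hvc', hr, hcan, h⟩) <;>
    obtain ⟨F⟩ := CycleForest.exists hg hG hvc'
  · exact F.not_configA hG.1 hg hvc' hcan (Or.inr hS) h
  · exact F.not_configD hG.1 hg hodd hvc' hS h
  · exact F.not_configE hG.1 hg hodd hvc' hcan hS h

lemma not_containsABC_of_isVertexMG (hG : IsUnicyclic G) (hg : 3 ≤ g) (heven : Even g)
    (hS : IsVertexMG G S) : ¬ ContainsABC G g vc S := by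
  rintro (⟨vc', hvc', hr, hcan, h⟩ | ⟨vc', hvc', hr, hcan, h⟩ | ⟨vc', hvc', hr, hcan, h⟩) <;>
    obtain ⟨F⟩ := CycleForest.exists hg hG hvc'
  · exact F.not_configA hG.1 hg hvc' hcan (Or.inl hS) h
  · exact F.not_configB hG.1 hg heven hvc' hS h
  · exact F.not_configC hG.1 hg hvc' hcan hS h

lemma branchResolving_and_biactive (hG : IsUnicyclic G) (hg : 3 ≤ g)
    (hvc : IsCycleLabelling G g vc) (hS : IsVertexMG G S ∨ IsEdgeMG G S) :
    BranchResolving G S ∧ Biactive G g vc S := by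
  obtain ⟨F⟩ := CycleForest.exists hg hG hvc
  exact ⟨branchResolving_of_isMG hG.1 hS, F.biactive_of_isMG hG.1 hg hvc hS⟩

end Main

theorem statement_13 {V : Type*} [Fintype V] [DecidableEq V] (G : SimpleGraph V)
    [DecidableRel G.Adj] (hG : IsUnicyclic G) (g : ℕ) (hg : 3 ≤ g)
    (vc : ZMod g → V) (hvc : IsCycleLabelling G g vc) :
    (Odd g → metricDim G ≤ edgeMetricDim G ∧
      (ABCneg G g vc ∧ ¬ ADEneg G g vc → metricDim G < edgeMetricDim G)) ∧
    (Even g → edgeMetricDim G ≤ metricDim G ∧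
      (¬ ABCneg G g vc ∧ ADEneg G g vc → edgeMetricDim G < metricDim G)) := by
  refine ⟨fun hodd => ⟨?_, ?_⟩, fun heven => ⟨?_, ?_⟩⟩
  · refine sInf_card_le ⟨_, isEdgeMG_univ hG.1⟩ fun S hS => ?_
    obtain ⟨hBR, hB⟩ := branchResolving_and_biactive hG hg hvc (Or.inr hS)
    exact isVertexMG_of_not_containsABC hG hg hodd hvc hBR hB fun h =>
      not_containsADE_of_isEdgeMG hG hg hodd hS (h.containsADE hodd)
  · rintro ⟨⟨T, hT, hABC⟩, hADE⟩
    exact sInf_card_lt ⟨_, isEdgeMG_univ hG.1⟩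
      (isVertexMG_of_not_containsABC hG hg hodd hvc hT.1 hT.2.1 hABC) fun S hS =>
      hT.card_lt hADE (branchResolving_and_biactive hG hg hvc (Or.inr hS))
        (not_containsADE_of_isEdgeMG hG hg hodd hS)
  · refine sInf_card_le ⟨_, isVertexMG_univ hG.1⟩ fun S hS => ?_
    obtain ⟨hBR, hB⟩ := branchResolving_and_biactive hG hg hvc (Or.inl hS)
    exact isEdgeMG_of_not_containsADE hG hg heven hvc hBR hB fun h =>
      not_containsABC_of_isVertexMG hG hg heven hS (h.containsABC hG hg heven)
  · rintro ⟨hABC, ⟨T, hT, hADE⟩⟩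
    exact sInf_card_lt ⟨_, isVertexMG_univ hG.1⟩
      (isEdgeMG_of_not_containsADE hG hg heven hvc hT.1 hT.2.1 hADE) fun S hS =>
      hT.card_lt hABC (branchResolving_and_biactive hG hg hvc (Or.inl hS))
        (not_containsABC_of_isVertexMG hG hg heven hS)
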